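/- arXiv:1405.4186 — 11 statements merged into one kernel-verified Lean document; each statement's English description precedes it below -/
import Mathlib

section
/- Let N be a positive integer that is not a perfect square, and let (a_n)_{n≥0} be the sequence of partial quotients of the continued fraction expansion of √N. Then (a_n) is eventually periodic: there exist n_0 ≥ 0 and L ≥ 1 such that a_{n+L} = a_n for all n ≥ n_0. -/
/-- The Gauss-map iterates of the continued fraction algorithm:
`cfX x 0 = x`, `cfX x (n+1) = 1 / (cfX x n - ⌊cfX x n⌋)`. -/
noncomputable def cfX (x : ℝ) : ℕ → ℝ
  | 0 => x
  | n + 1 => 1 / (cfX x n - ⌊cfX x n⌋)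

/-- The `n`-th partial quotient of the continued fraction expansion of `x`. -/
noncomputable def cfA (x : ℝ) (n : ℕ) : ℤ := ⌊cfX x n⌋

theorem cf_inv (N : ℕ) (hsq : ¬ IsSquare N) (n : ℕ) :
    ∃ P Q : ℤ, P ^ 2 < N ∧ 0 < Q ∧ Q ∣ N - P ^ 2 ∧
      cfX (Real.sqrt (N : ℝ)) n = (P + Real.sqrt (N : ℝ)) / Q := by
  have hs0 : 0 ≤ Real.sqrt (N : ℝ) := Real.sqrt_nonneg _
  have hs2 : Real.sqrt (N : ℝ) ^ 2 = N := Real.sq_sqrt (Nat.cast_nonneg N)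
  induction n with
  | zero =>
    refine ⟨0, 1, ?_, one_pos, one_dvd _, by simp [cfX]⟩
    have : N ≠ 0 := by
      rintro rfl
      exact hsq ⟨0, rfl⟩
    have : 0 < N := Nat.pos_of_ne_zero this
    simpa using this
  | succ n ih =>
    obtain ⟨P, Q, hP, hQ, ⟨R, hR⟩, hx⟩ := ih
    rw [cfX, hx]
    generalize Real.sqrt (N : ℝ) = s at *
    have hQr : (0 : ℝ) < Q := by exact_mod_cast hQ
    have hPr : (P : ℝ) ^ 2 < s ^ 2 := by rw [hs2]; exact_mod_cast hP
    have hab := abs_lt_of_sq_lt_sq' hPr hs0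
    have ha0 : 0 ≤ ⌊((P : ℝ) + s) / Q⌋ :=
      Int.floor_nonneg.2 (div_nonneg (by linarith [hab.1]) hQr.le)
    have ha1 : (⌊((P : ℝ) + s) / Q⌋ : ℝ) ≤ ((P : ℝ) + s) / Q := Int.floor_le _
    generalize ⌊((P : ℝ) + s) / Q⌋ = a at *
    rw [le_div_iff₀ hQr] at ha1
    have ha0r : (0 : ℝ) ≤ a := by exact_mod_cast ha0
    have haQ : (0 : ℝ) ≤ a * Q := mul_nonneg ha0r hQr.le
    have hle : (a * Q - P : ℝ) ^ 2 ≤ N := by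
      rw [← hs2]
      nlinarith [hab.2]
    have hle' : (a * Q - P) ^ 2 ≤ (N : ℤ) := by exact_mod_cast hle
    have hne : (a * Q - P) ^ 2 ≠ (N : ℤ) := by
      intro h
      apply hsq
      refine ⟨(a * Q - P).natAbs, ?_⟩
      zify
      rw [abs_mul_abs_self, ← h, sq]
    have hlt : (a * Q - P) ^ 2 < (N : ℤ) := lt_of_le_of_ne hle' hne
    have hfac : (N : ℤ) - (a * Q - P) ^ 2 = Q * (R - a ^ 2 * Q + 2 * a * P) := by
      linear_combination hR
    have hQ' : 0 < R - a ^ 2 * Q + 2 * a * P := by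
      apply pos_of_mul_pos_right _ hQ.le
      rw [← hfac]; linarith
    refine ⟨a * Q - P, R - a ^ 2 * Q + 2 * a * P, hlt, hQ', ⟨Q, by rw [hfac, mul_comm]⟩, ?_⟩
    generalize R - a ^ 2 * Q + 2 * a * P = Q' at *
    have hQr' : (0 : ℝ) < Q' := by exact_mod_cast hQ'
    have hfr : (N : ℝ) - (a * Q - P) ^ 2 = Q * Q' := by exact_mod_cast hfac
    have hprod : (P + s - a * Q) * (a * Q - P + s) = Q * Q' := by
      rw [← hfr, ← hs2]; ring
    have hne2 : (P + s - a * Q) ≠ 0 := by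
      intro h
      rw [h, zero_mul] at hprod
      exact (mul_pos hQr hQr').ne hprod
    have e : (P + s) / (Q : ℝ) - a = (P + s - a * Q) / Q := by
      field_simp
    rw [e, one_div_div, div_eq_div_iff hne2 hQr'.ne']
    push_cast
    linarith

theorem cf_periodic (x : ℝ) (m L : ℕ) (h : cfX x (m + L) = cfX x m) (k : ℕ) :
    cfX x (m + k + L) = cfX x (m + k) := by
  induction k with
  | zero => exact h
  | succ k ih =>
    have e : m + (k + 1) + L = (m + k + L) + 1 := by ring
    rw [e, ← add_assoc, cfX, cfX, ih]

theorem sqrt_nat_cf_eventually_periodic (N : ℕ) (hN : 0 < N) (hsq : ¬ IsSquare N) :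
    ∃ n₀ L : ℕ, 1 ≤ L ∧
      ∀ n, n₀ ≤ n → cfA (Real.sqrt (N : ℝ)) (n + L) = cfA (Real.sqrt (N : ℝ)) n := by
  have hfin : (Set.range (cfX (Real.sqrt (N : ℝ)))).Finite := by
    apply ((((Set.finite_Icc (-(N : ℤ)) N).prod (Set.finite_Icc (-(N : ℤ)) N))).image
      (fun p : ℤ × ℤ => ((p.1 : ℝ) + Real.sqrt (N : ℝ)) / p.2)).subset
    rintro _ ⟨n, rfl⟩
    obtain ⟨P, Q, hP, hQ, hd, hx⟩ := cf_inv N hsq n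
    refine ⟨(P, Q), ⟨⟨?_, ?_⟩, ⟨?_, ?_⟩⟩, hx.symm⟩
    · show -(N : ℤ) ≤ P
      nlinarith
    · show P ≤ (N : ℤ)
      nlinarith
    · show -(N : ℤ) ≤ Q
      linarith [sq_nonneg P]
    · show Q ≤ (N : ℤ)
      have := Int.le_of_dvd (by linarith) hd
      linarith [sq_nonneg P]
  have hni : ¬ Function.Injective (cfX (Real.sqrt (N : ℝ))) := fun hi =>
    Set.infinite_range_of_injective hi hfin
  obtain ⟨i, j, hij, hlt⟩ : ∃ i j, cfX (Real.sqrt (N : ℝ)) i = cfX (Real.sqrt (N : ℝ)) j ∧ i < j := by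
    simp only [Function.Injective, not_forall] at hni
    obtain ⟨i, j, h, hne⟩ := hni
    rcases lt_or_gt_of_ne hne with h1 | h1
    · exact ⟨i, j, h, h1⟩
    · exact ⟨j, i, h.symm, h1⟩
  refine ⟨i, j - i, by omega, fun n hn => ?_⟩
  obtain ⟨k, rfl⟩ := Nat.exists_eq_add_of_le hn
  unfold cfA
  rw [cf_periodic _ i (j - i) (by rw [Nat.add_sub_cancel' hlt.le, hij]) k]
end

section
/- Let N be a positive integer that is not a perfect square, and let (a_n)_{n≥0} be the sequence of partial quotients of the continued fraction expansion of √N. Then the expansion is palindromically periodic: there exists L ≥ 1 such that a_{n+L} = a_n for all n ≥ 1, a_L = 2·a_0, and a_j = a_{L−j} for all j with 1 ≤ j ≤ L−1; that is, the expansion has the form [a_0; period(k_1, …, k_{L−1}, 2a_0)] where the tuple (k_1, …, k_{L−1}) is a palindrome. -/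
namespace PalCF

/-- Reduced triples `(q, P, Q)` relative to `s = √N`. -/
def Red (s : ℝ) (t : ℤ × ℤ × ℤ) : Prop :=
  0 < t.1 ∧ 0 < t.2.2 ∧ (t.1 : ℝ) * t.2.2 + (t.2.1 : ℝ) ^ 2 = s ^ 2 ∧ (t.2.1 : ℝ) < s ∧
    s - t.2.1 < t.1 ∧ (t.1 : ℝ) < s + t.2.1 ∧ s - t.2.1 < t.2.2 ∧ (t.2.2 : ℝ) < s + t.2.1

noncomputable def val (s : ℝ) (t : ℤ × ℤ × ℤ) : ℝ := (t.2.1 + s) / t.2.2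

noncomputable def A (s : ℝ) (t : ℤ × ℤ × ℤ) : ℤ := ⌊val s t⌋

noncomputable def T (s : ℝ) (t : ℤ × ℤ × ℤ) : ℤ × ℤ × ℤ :=
  (t.2.2, A s t * t.2.2 - t.2.1, t.1 + A s t * (t.2.1 - (A s t * t.2.2 - t.2.1)))

def sg (t : ℤ × ℤ × ℤ) : ℤ × ℤ × ℤ := (t.2.2, t.2.1, t.1)

lemma sg_sg (t : ℤ × ℤ × ℤ) : sg (sg t) = t := rfl

lemma Red.sg {s : ℝ} {t : ℤ × ℤ × ℤ} (h : Red s t) : Red s (sg t) := by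
  obtain ⟨h1, h2, h3, h4, h5, h6, h7, h8⟩ := h
  exact ⟨h2, h1, by simp only [PalCF.sg]; linarith, h4, h7, h8, h5, h6⟩

lemma Red.mk' {s : ℝ} {q P Q : ℤ} (h1 : 0 < q) (h3 : (q : ℝ) * Q + (P : ℝ) ^ 2 = s ^ 2)
    (h4 : (P : ℝ) < s) (h5 : s - P < q) (h6 : (q : ℝ) < s + P) : Red s (q, P, Q) := by
  have hq : (0 : ℝ) < q := by exact_mod_cast h1
  have hf : (q : ℝ) * Q = (s - P) * (s + P) := by linarith
  have ha : 0 < s - P := by linarith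
  have hb : 0 < s + P := by linarith
  have hQ : (0 : ℝ) < Q := by
    by_contra hc
    have := mul_pos ha hb
    nlinarith
  refine ⟨h1, by exact_mod_cast hQ, h3, h4, h5, h6, ?_, ?_⟩ <;> dsimp only
  · by_contra hc
    push Not at hc
    nlinarith
  · by_contra hc
    push Not at hc
    nlinarith

lemma A_bounds {s : ℝ} (hs : Irrational s) {t : ℤ × ℤ × ℤ} (h : Red s t) :
    (A s t : ℝ) * t.2.2 < t.2.1 + s ∧ t.2.1 + s < (A s t + 1 : ℝ) * t.2.2 ∧ 1 ≤ A s t := by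
  obtain ⟨h1, h2, h3, h4, h5, h6, h7, h8⟩ := h
  have hQ : (0 : ℝ) < t.2.2 := by exact_mod_cast h2
  have e1 : (A s t : ℝ) ≤ val s t := Int.floor_le _
  have e2 : val s t < A s t + 1 := Int.lt_floor_add_one _
  unfold val at e1 e2
  rw [le_div_iff₀ hQ] at e1
  rw [div_lt_iff₀ hQ] at e2
  refine ⟨lt_of_le_of_ne e1 ?_, e2, ?_⟩
  · intro he
    apply hs.ne_int (A s t * t.2.2 - t.2.1)
    push_cast
    linarith
  · apply Int.le_floor.2
    unfold val
    rw [le_div_iff₀ hQ]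
    push_cast
    linarith

lemma Red.T {s : ℝ} (hs : Irrational s) {t : ℤ × ℤ × ℤ} (h : Red s t) : Red s (T s t) := by
  obtain ⟨a1, a2, a3⟩ := A_bounds hs h
  obtain ⟨h1, h2, h3, h4, h5, h6, h7, h8⟩ := h
  have hQ : (0 : ℝ) < t.2.2 := by exact_mod_cast h2
  have a3' : (1 : ℝ) ≤ A s t := by exact_mod_cast a3
  apply Red.mk' h2 <;> push_cast
  · linear_combination h3
  · linarith
  · linarith
  · nlinarith

lemma A_sg_T {s : ℝ} {t : ℤ × ℤ × ℤ} (h : Red s t) : A s (sg (T s t)) = A s t := by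
  obtain ⟨h1, h2, h3, h4, h5, h6, h7, h8⟩ := h
  have hQ : (0 : ℝ) < t.2.2 := by exact_mod_cast h2
  conv_lhs => unfold A
  rw [Int.floor_eq_iff]
  simp only [val, sg, T]
  rw [le_div_iff₀ hQ, div_lt_iff₀ hQ]
  push_cast
  constructor <;> linarith

lemma T_sg_T {s : ℝ} {t : ℤ × ℤ × ℤ} (h : Red s t) : T s (sg (T s t)) = sg t := by
  have e := A_sg_T h
  rw [T, e]
  simp only [sg, T]
  refine Prod.ext rfl (Prod.ext ?_ ?_) <;> dsimp only <;> ring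

lemma val_T {s : ℝ} (hs : Irrational s) {t : ℤ × ℤ × ℤ} (h : Red s t) :
    val s (T s t) = 1 / (val s t - ⌊val s t⌋) := by
  obtain ⟨a1, a2, a3⟩ := A_bounds hs h
  have h' := Red.T hs h
  obtain ⟨h1, h2, h3, h4, h5, h6, h7, h8⟩ := h
  obtain ⟨-, k2, k3, -⟩ := h'
  have hQ : (0 : ℝ) < t.2.2 := by exact_mod_cast h2
  have hQ' : (0 : ℝ) < (T s t).2.2 := by exact_mod_cast k2
  have e : val s t - ⌊val s t⌋ = (t.2.1 + s - A s t * t.2.2) / t.2.2 := by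
    change val s t - A s t = _
    unfold val
    field_simp
  have hp : (0 : ℝ) < t.2.1 + s - A s t * t.2.2 := by linarith
  rw [e, one_div_div, val, div_eq_div_iff hQ'.ne' hp.ne']
  have e1 : ((T s t).2.1 : ℝ) = A s t * t.2.2 - t.2.1 := by simp [T]
  have e2 : ((T s t).1 : ℝ) = t.2.2 := by simp [T]
  rw [e1, e2] at k3
  rw [e1]
  linear_combination -k3

lemma Red.iter {s : ℝ} (hs : Irrational s) {t : ℤ × ℤ × ℤ} (h : Red s t) (n : ℕ) :
    Red s ((PalCF.T s)^[n] t) := by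
  induction n with
  | zero => exact h
  | succ n ih => rw [Function.iterate_succ_apply']; exact ih.T hs

lemma finite_red (s : ℝ) : {t | Red s t}.Finite := by
  apply (Set.finite_Icc ((0, -⌈2*s⌉, 0) : ℤ × ℤ × ℤ) (⌈2*s⌉, ⌈2*s⌉, ⌈2*s⌉)).subset
  rintro ⟨q, P, Q⟩ ⟨h1, h2, h3, h4, h5, h6, h7, h8⟩
  dsimp only at *
  have hc := Int.le_ceil (2 * s)
  have hq : (0 : ℝ) < q := by exact_mod_cast h1
  have g1 : q ≤ ⌈2*s⌉ := by
    have : (q : ℝ) ≤ ⌈2*s⌉ := by linarith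
    exact_mod_cast this
  have g2 : Q ≤ ⌈2*s⌉ := by
    have : (Q : ℝ) ≤ ⌈2*s⌉ := by linarith
    exact_mod_cast this
  have g3 : P ≤ ⌈2*s⌉ := by
    have : (P : ℝ) ≤ ⌈2*s⌉ := by linarith
    exact_mod_cast this
  have g4 : -⌈2*s⌉ ≤ P := by
    have : (-⌈2*s⌉ : ℝ) ≤ P := by linarith
    exact_mod_cast this
  exact ⟨⟨h1.le, g4, h2.le⟩, ⟨g1, g3, g2⟩⟩

lemma exists_period {s : ℝ} (hs : Irrational s) {t : ℤ × ℤ × ℤ} (h : Red s t) :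
    ∃ L, 1 ≤ L ∧ (T s)^[L] t = t := by
  have hinj : ∀ u v, Red s u → Red s v → T s u = T s v → u = v := by
    intro u v hu hv e
    have := T_sg_T hu
    rw [e, T_sg_T hv] at this
    rw [← sg_sg u, ← this, sg_sg]
  have key : ∀ i k, (T s)^[i + k] t = (T s)^[i] t → (T s)^[k] t = t := by
    intro i k
    induction i with
    | zero => intro e; simpa using e
    | succ i ih =>
      intro e
      apply ih
      rw [show i + 1 + k = (i + k) + 1 by ring, Function.iterate_succ_apply',
        Function.iterate_succ_apply'] at e
      exact hinj _ _ (h.iter hs _) (h.iter hs _) e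
  obtain ⟨i, -, j, -, hne, e⟩ := Set.infinite_univ.exists_ne_map_eq_of_mapsTo
    (f := fun n : ℕ => (T s)^[n] t) (t := {t | Red s t}) (fun n _ => h.iter hs n) (finite_red s)
  rcases lt_or_gt_of_ne hne with hl | hl
  · obtain ⟨k, rfl⟩ := Nat.exists_eq_add_of_lt hl
    exact ⟨k + 1, by omega, key i (k + 1) e.symm⟩
  · obtain ⟨k, rfl⟩ := Nat.exists_eq_add_of_lt hl
    exact ⟨k + 1, by omega, key j (k + 1) e⟩

end PalCF

open PalCF

theorem sqrt_nat_cf_palindromically_periodic (N : ℕ) (hN : 0 < N) (hsq : ¬ IsSquare N) :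
    ∃ L : ℕ, 1 ≤ L ∧
      (∀ n, 1 ≤ n → cfA (Real.sqrt (N : ℝ)) (n + L) = cfA (Real.sqrt (N : ℝ)) n) ∧
      cfA (Real.sqrt (N : ℝ)) L = 2 * cfA (Real.sqrt (N : ℝ)) 0 ∧
      (∀ j, 1 ≤ j → j ≤ L - 1 → cfA (Real.sqrt (N : ℝ)) j = cfA (Real.sqrt (N : ℝ)) (L - j)) := by
  have hs : Irrational (Real.sqrt (N : ℝ)) := irrational_sqrt_natCast_iff.2 hsq
  have hs2 : (Real.sqrt (N : ℝ)) ^ 2 = N := Real.sq_sqrt (Nat.cast_nonneg N)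
  have hs1 : 1 ≤ Real.sqrt (N : ℝ) := by
    rw [Real.one_le_sqrt]; exact_mod_cast hN
  generalize Real.sqrt (N : ℝ) = s at *
  obtain ⟨a, ha⟩ : ∃ a, a = ⌊s⌋ := ⟨_, rfl⟩
  have ha1 : (a : ℝ) ≤ s := ha ▸ Int.floor_le s
  have ha2 : s < a + 1 := ha ▸ Int.lt_floor_add_one s
  have ha3 : (a : ℝ) < s := lt_of_le_of_ne ha1 (hs.ne_int a).symm
  have ha4 : (1 : ℝ) ≤ a := by
    have : 1 ≤ a := ha ▸ Int.le_floor.2 (by simpa using hs1)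
    exact_mod_cast this
  obtain ⟨t, ht⟩ : ∃ t : ℤ × ℤ × ℤ, t = (N - a ^ 2, a, 1) := ⟨_, rfl⟩
  have hr : Red s t := by
    have : Red s (sg t) := by
      subst ht
      apply Red.mk' (by norm_num) <;> push_cast <;> linarith
    exact this.sg
  have hv : val s t = s + a := by subst ht; simp [val]; ring
  have hA : A s t = 2 * a := by
    unfold A; rw [hv, Int.floor_add_intCast, ← ha]; ring
  have hT : T s t = sg t := by
    unfold T; rw [hA]; subst ht
    refine Prod.ext rfl (Prod.ext ?_ ?_) <;> simp only [sg] <;> ring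
  have hX : ∀ n, cfX s (n + 1) = val s ((T s)^[n + 1] t) := by
    intro n
    induction n with
    | zero =>
      rw [Function.iterate_one, val_T hs hr, hv, Int.floor_add_intCast]
      simp [cfX]
    | succ n ih =>
      rw [Function.iterate_succ_apply', val_T hs (hr.iter hs _), ← ih]
      rfl
  have hC : ∀ n, 1 ≤ n → cfA s n = A s ((T s)^[n] t) := by
    intro n hn
    obtain ⟨m, rfl⟩ := Nat.exists_eq_add_of_le' hn
    unfold cfA A
    rw [hX]
  obtain ⟨L, hL, hp⟩ := exists_period hs hr
  have hpal : ∀ j, j ≤ L → sg ((T s)^[L - j] t) = (T s)^[j + 1] t := by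
    intro j
    induction j with
    | zero => intro _; simp [hp, hT]
    | succ j ih =>
      intro hj
      have := ih (by omega)
      rw [Function.iterate_succ_apply', ← this, show L - j = (L - (j + 1)) + 1 by omega,
        Function.iterate_succ_apply', T_sg_T (hr.iter hs _)]
  refine ⟨L, hL, ?_, ?_, ?_⟩
  · intro n hn
    rw [hC _ (by omega), hC _ hn, Function.iterate_add_apply, hp]
  · rw [hC _ hL, hp, hA, ha]; rfl
  · intro j hj hjL
    rw [hC _ hj, hC _ (by omega), ← A_sg_T (hr.iter hs (L - j)), ← Function.iterate_succ_apply' (T s)]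
    have := hpal (j - 1) (by omega)
    rw [show L - (j - 1) = (L - j).succ by omega, show j - 1 + 1 = j by omega] at this
    rw [this]
end

section
/- Let r > 1 be a rational number that is not the square of any rational number, and let (a_n)_{n≥0} be the sequence of partial quotients of the continued fraction expansion of √r. Then the expansion is palindromically periodic: there exists L ≥ 1 such that a_{n+L} = a_n for all n ≥ 1, a_L = 2·a_0, and a_j = a_{L−j} for all j with 1 ≤ j ≤ L−1. -/
noncomputable def cfW (x : ℝ) : ℕ → ℝ
  | 0 => x
  | n + 1 => 1 / (cfW x n + cfA x n)

lemma cfX_irr (x : ℝ) (hx : Irrational x) (n : ℕ) : Irrational (cfX x n) := by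
  induction n with
  | zero => exact hx
  | succ n ih =>
    rw [cfX, one_div]
    exact (ih.sub_intCast _).inv

lemma cfX_succ_inv (x : ℝ) (n : ℕ) : 1 / cfX x (n + 1) = cfX x n - cfA x n := by
  rw [cfX, one_div_one_div]; rfl

lemma cfX_fract (x : ℝ) (hx : Irrational x) (n : ℕ) :
    0 < cfX x n - cfA x n ∧ cfX x n - cfA x n < 1 := by
  have h1 := Int.floor_le (cfX x n)
  have h2 := Int.lt_floor_add_one (cfX x n)
  have h3 := (cfX_irr x hx n).ne_int ⌊cfX x n⌋
  have h4 := lt_of_le_of_ne h1 (Ne.symm h3)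
  unfold cfA
  constructor <;> linarith

lemma cfX_gt (x : ℝ) (hx : Irrational x) (h1 : 1 < x) (n : ℕ) : 1 < cfX x n := by
  cases n with
  | zero => exact h1
  | succ n =>
    obtain ⟨h2, h3⟩ := cfX_fract x hx n
    rw [cfX]
    exact (one_lt_div h2).2 h3

lemma cfA_ge (x : ℝ) (hx : Irrational x) (h1 : 1 < x) (n : ℕ) : (1 : ℝ) ≤ cfA x n := by
  have : 1 ≤ cfA x n := Int.le_floor.2 (by simpa using (cfX_gt x hx h1 n).le)
  exact_mod_cast this

lemma cfW_pos (x : ℝ) (hx : Irrational x) (h1 : 1 < x) (n : ℕ) : 0 < cfW x n := by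
  induction n with
  | zero => rw [cfW]; linarith
  | succ n ih =>
    have := cfA_ge x hx h1 n
    rw [cfW]; positivity

lemma cfW_lt (x : ℝ) (hx : Irrational x) (h1 : 1 < x) (n : ℕ) : cfW x (n + 1) < 1 := by
  have := cfA_ge x hx h1 n
  have h := cfW_pos x hx h1 n
  rw [cfW, div_lt_one (by linarith)]
  linarith

lemma cfW_inv (x : ℝ) (n : ℕ) : 1 / cfW x (n + 1) = cfW x n + cfA x n := by
  rw [cfW, one_div_one_div]

lemma floor_uniq (a b : ℤ) (u v : ℝ) (hu : 0 ≤ u) (hu1 : u < 1) (hv : 0 ≤ v) (hv1 : v < 1)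
    (h : u + a = v + b) : a = b ∧ u = v := by
  have h1 : (a : ℝ) < b + 1 := by linarith
  have h2 : (b : ℝ) < a + 1 := by linarith
  have h3 : a < b + 1 := by exact_mod_cast h1
  have h4 : b < a + 1 := by exact_mod_cast h2
  have : a = b := by omega
  subst this
  exact ⟨rfl, by linarith⟩

lemma cf_form (x s : ℝ) (q D : ℤ) (hq : q ≠ 0) (hs : Irrational s) (hD : s ^ 2 = D)
    (hqD : q ∣ D) (hx : x = s / q) (n : ℕ) :
    ∃ P Q : ℤ, Q ≠ 0 ∧ Q ∣ D - P ^ 2 ∧ cfX x n = (s + P) / Q ∧ cfW x n = (s - P) / Q := by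
  induction n with
  | zero => exact ⟨0, q, hq, by simpa using hqD, by simp [cfX, hx], by simp [cfW, hx]⟩
  | succ n ih =>
    obtain ⟨P, Q, hQ, ⟨c, hc⟩, hX, hW⟩ := ih
    set a := cfA x n with ha
    have hQr : (Q : ℝ) ≠ 0 := by exact_mod_cast hQ
    have e : D - (a * Q - P) ^ 2 = Q * (c + 2 * a * P - a ^ 2 * Q) := by linear_combination hc
    have er : s ^ 2 - ((a * Q - P : ℤ) : ℝ) ^ 2 = Q * (c + 2 * a * P - a ^ 2 * Q : ℤ) := by
      rw [hD]; exact_mod_cast e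
    generalize hQ' : c + 2 * a * P - a ^ 2 * Q = Q' at e er
    have n1 : s - ((a * Q - P : ℤ) : ℝ) ≠ 0 := sub_ne_zero.2 (hs.ne_int _)
    have n2 : s + ((a * Q - P : ℤ) : ℝ) ≠ 0 := by
      have := hs.ne_int (-(a * Q - P))
      intro h; apply this; push_cast at h ⊢; linarith
    have hQ'r : (Q' : ℝ) ≠ 0 := by
      intro h
      rw [h, mul_zero] at er
      exact mul_ne_zero n1 n2 (by linear_combination er)
    refine ⟨a * Q - P, Q', by exact_mod_cast hQ'r, ⟨Q, by linear_combination e⟩, ?_, ?_⟩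
    · have : cfX x n - cfA x n = (s - ((a * Q - P : ℤ) : ℝ)) / Q := by
        rw [hX, ← ha]; push_cast; field_simp; ring
      rw [← one_div_one_div (cfX x (n+1)), cfX_succ_inv, this, one_div_div,
        div_eq_div_iff n1 hQ'r]
      linear_combination -er
    · have : cfW x n + cfA x n = (s + ((a * Q - P : ℤ) : ℝ)) / Q := by
        rw [hW, ← ha]; push_cast; field_simp; ring
      rw [cfW, this, one_div_div, div_eq_div_iff n2 hQ'r]
      linear_combination -er

lemma cf_repeat (x s : ℝ) (q D : ℤ) (hq : q ≠ 0) (hs : Irrational s) (hs0 : 0 < s)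
    (hD : s ^ 2 = D)
    (hqD : q ∣ D) (hx : x = s / q) (hxi : Irrational x) (h1 : 1 < x) :
    ∃ m L : ℕ, 1 ≤ L ∧ cfX x (m + 1 + L) = cfX x (m + 1) ∧ cfW x (m + 1 + L) = cfW x (m + 1) := by
  let S : Set (ℝ × ℝ) := (fun p : ℤ × ℤ => ((s + p.1) / p.2, (s - p.1) / p.2)) ''
    (Set.Icc (0, 0) (⌈2 * s⌉, ⌈2 * s⌉))
  have hS : S.Finite := (Set.finite_Icc _ _).image _
  have hm : Set.MapsTo (fun n : ℕ => (cfX x (n+1), cfW x (n+1))) Set.univ S := by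
    intro n _
    obtain ⟨P, Q, hQ, -, hX, hW⟩ := cf_form x s q D hq hs hD hqD hx (n+1)
    have b1 := cfX_gt x hxi h1 (n+1)
    have b2 := cfW_pos x hxi h1 (n+1)
    have b3 := cfW_lt x hxi h1 n
    have hQr : (Q : ℝ) ≠ 0 := by exact_mod_cast hQ
    have e1 : cfX x (n+1) * Q = s + P := by rw [hX]; field_simp
    have e2 : cfW x (n+1) * Q = s - P := by rw [hW]; field_simp
    have Qpos : (0:ℝ) < Q := by
      by_contra h
      push Not at h
      nlinarith
    have k1 : (Q : ℝ) ≤ 2 * s := by nlinarith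
    have k2 : (0 : ℝ) ≤ P := by nlinarith
    have k3 : (P : ℝ) ≤ 2 * s := by nlinarith
    refine ⟨(P, Q), ⟨⟨?_, ?_⟩, ⟨?_, ?_⟩⟩, ?_⟩
    · exact_mod_cast k2
    · exact_mod_cast Qpos.le
    · exact_mod_cast k3.trans (Int.le_ceil _)
    · exact_mod_cast k1.trans (Int.le_ceil _)
    · simp [hX, hW]
  obtain ⟨i, -, j, -, hij, h⟩ := Set.infinite_univ.exists_ne_map_eq_of_mapsTo hm hS
  simp only [Prod.mk.injEq] at h
  rcases lt_or_gt_of_ne hij with hl | hl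
  · refine ⟨i, j - i, by omega, ?_⟩
    rw [show i + 1 + (j - i) = j + 1 by omega]
    exact ⟨h.1.symm, h.2.symm⟩
  · refine ⟨j, i - j, by omega, ?_⟩
    rw [show j + 1 + (i - j) = i + 1 by omega]
    exact h

lemma cf_down (x : ℝ) (hxi : Irrational x) (h1 : 1 < x) (L m : ℕ)
    (hX : cfX x (m + 1 + L) = cfX x (m + 1)) (hW : cfW x (m + 1 + L) = cfW x (m + 1)) :
    cfX x (1 + L) = cfX x 1 ∧ cfW x (1 + L) = cfW x 1 := by
  induction m with
  | zero => simpa using ⟨hX, hW⟩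
  | succ m ih =>
    have e : m + 1 + 1 + L = m + L + 1 + 1 := by ring
    have e' : m + 1 + L = m + L + 1 := by ring
    rw [e] at hX hW
    rw [e'] at ih
    have w := congrArg (fun t => 1 / t) hW
    have v := congrArg (fun t => 1 / t) hX
    simp only [cfW_inv, cfX_succ_inv] at w v
    obtain ⟨ha, hw⟩ := floor_uniq _ _ _ _ (cfW_pos x hxi h1 _).le (cfW_lt x hxi h1 _)
      (cfW_pos x hxi h1 _).le (cfW_lt x hxi h1 _) w
    rw [ha] at v
    exact ih (by linarith) hw

theorem sqrt_rat_cf_palindromically_periodic (r : ℚ) (hr : 1 < r)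
    (hsq : ¬ ∃ q : ℚ, q ^ 2 = r) :
    ∃ L : ℕ, 1 ≤ L ∧
      (∀ n, 1 ≤ n → cfA (Real.sqrt (r : ℝ)) (n + L) = cfA (Real.sqrt (r : ℝ)) n) ∧
      cfA (Real.sqrt (r : ℝ)) L = 2 * cfA (Real.sqrt (r : ℝ)) 0 ∧
      (∀ j, 1 ≤ j → j ≤ L - 1 → cfA (Real.sqrt (r : ℝ)) j = cfA (Real.sqrt (r : ℝ)) (L - j)) := by
  have hr' : (1 : ℝ) < r := by exact_mod_cast hr
  have hsqr : Real.sqrt (r : ℝ) ^ 2 = r := Real.sq_sqrt (by linarith)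
  have hxi : Irrational (Real.sqrt (r : ℝ)) := by
    rintro ⟨t, ht⟩
    apply hsq
    refine ⟨t, ?_⟩
    rw [← ht] at hsqr
    exact_mod_cast hsqr
  have h1 : 1 < Real.sqrt (r : ℝ) := by
    rw [Real.lt_sqrt (by norm_num)]; simpa using hr'
  have hden : (r.den : ℝ) ≠ 0 := by exact_mod_cast r.den_nz
  have hdenp : (0 : ℝ) < r.den := by exact_mod_cast r.den_pos
  have hrn : (r : ℝ) * r.den = r.num := by exact_mod_cast Rat.mul_den_eq_num r
  generalize Real.sqrt (r : ℝ) = x at *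
  obtain ⟨m, L, hL, hX, hW⟩ := cf_repeat x (x * r.den) r.den (r.num * r.den)
    (by exact_mod_cast r.den_nz) (hxi.mul_natCast r.den_nz) (by positivity)
    (by push_cast; rw [← hrn, mul_pow, hsqr]; ring) (Dvd.intro_left _ rfl)
    (by push_cast; field_simp) hxi h1
  obtain ⟨hX, hW⟩ := cf_down x hxi h1 L m hX hW
  have hper : ∀ n, cfX x (n + 1 + L) = cfX x (n + 1) := by
    intro n
    induction n with
    | zero => simpa using hX
    | succ n ih =>
      rw [show n + 1 + 1 + L = (n + 1 + L) + 1 by ring, cfX, ih, ← cfX]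
  obtain ⟨K, rfl⟩ : ∃ K, L = K + 1 := ⟨L - 1, by omega⟩
  have hw := congrArg (fun t => 1 / t) hW
  rw [show 1 + (K + 1) = K + 1 + 1 by ring, show 1 = 0 + 1 by rfl] at hw
  simp only [cfW_inv] at hw
  have f0 := cfX_fract x hxi 0
  have hx0 : cfX x 0 = x := rfl
  have hw0 : cfW x 0 = x := rfl
  obtain ⟨ha, hwf⟩ := floor_uniq (cfA x (K + 1)) (2 * cfA x 0) (cfW x (K+1)) (x - cfA x 0)
    (cfW_pos x hxi h1 _).le (cfW_lt x hxi h1 _) (by linarith) (by linarith)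
    (by push_cast; linarith)
  have key : ∀ k, k ≤ K → cfW x (K + 1 - k) = 1 / cfX x (k + 1) ∧
      (1 ≤ k → cfA x k = cfA x (K + 1 - k)) := by
    intro k
    induction k with
    | zero => intro _; exact ⟨by rw [cfX_succ_inv]; simpa [hx0] using hwf, by omega⟩
    | succ k ih =>
      intro hk
      obtain ⟨h, -⟩ := ih (by omega)
      obtain ⟨M, hM⟩ : ∃ M, K = k + 1 + M := ⟨K - (k + 1), by omega⟩
      rw [show K + 1 - k = M + 1 + 1 by omega] at h
      rw [show K + 1 - (k + 1) = M + 1 by omega]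
      have h' := congrArg (fun t => 1 / t) h
      simp only [cfW_inv, one_div_one_div] at h'
      have f := cfX_fract x hxi (k+1)
      obtain ⟨u, v⟩ := floor_uniq (cfA x (M+1)) (cfA x (k+1)) (cfW x (M+1))
        (cfX x (k+1) - cfA x (k+1)) (cfW_pos x hxi h1 _).le (cfW_lt x hxi h1 _) f.1.le f.2
        (by linarith)
      exact ⟨by rw [cfX_succ_inv, v], fun _ => u.symm⟩
  refine ⟨K + 1, hL, ?_, ha, fun j hj hj' => (key j (by omega)).2 hj⟩
  intro n hn
  obtain ⟨n, rfl⟩ : ∃ k, n = k + 1 := ⟨n - 1, by omega⟩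
  unfold cfA
  rw [hper]
end

section
/- (Incremental Logos Criterion, part (d).) Let α > β > 0 be real numbers with α/β irrational, with anthyphairesis quotients (I_n) and increment factors (φ_n). If there exist indices 1 ≤ n < m with φ_n = φ_m, then the quotient sequence is eventually periodic with period m − n: I_{k+(m−n)} = I_k for all k ≥ n, so that the anthyphairesis of (α, β) equals [I_0, I_1, …, I_{n−1}, period(I_n, …, I_{m−1})]. -/
/-- The anthyphairesis remainders of `(α, β)`:
`γ 0 = β`, `γ 1 = α - ⌊α/β⌋·β`, `γ (n+2) = γ n - ⌊γ n / γ (n+1)⌋ · γ (n+1)`. -/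
noncomputable def anthGamma (α β : ℝ) : ℕ → ℝ
  | 0 => β
  | 1 => α - ⌊α / β⌋ * β
  | n + 2 => anthGamma α β n - ⌊anthGamma α β n / anthGamma α β (n + 1)⌋ * anthGamma α β (n + 1)

/-- The anthyphairesis quotients of `(α, β)`:
`I 0 = ⌊α/β⌋`, `I (n+1) = ⌊γ n / γ (n+1)⌋`. -/
noncomputable def anthI (α β : ℝ) : ℕ → ℤ
  | 0 => ⌊α / β⌋
  | n + 1 => ⌊anthGamma α β n / anthGamma α β (n + 1)⌋

/-- The increment factors `φ n = β · γ n / γ (n-1)` (meaningful for `n ≥ 1`). -/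
noncomputable def anthPhi (α β : ℝ) (n : ℕ) : ℝ :=
  β * anthGamma α β n / anthGamma α β (n - 1)

theorem irr_inv_fract (x : ℝ) (h : Irrational x) : Irrational (x - ⌊x⌋)⁻¹ :=
  (h.sub_intCast _).inv

theorem anth_step (a b : ℝ) (hb : b ≠ 0) :
    b / (a - ⌊a / b⌋ * b) = (a / b - ⌊a / b⌋)⁻¹ := by
  have : a - ⌊a / b⌋ * b = (a / b - ⌊a / b⌋) * b := by
    rw [sub_mul, div_mul_cancel₀ _ hb]
  rw [this, div_mul_cancel_right₀ hb]

theorem anth_irr (α β : ℝ) (hβ : 0 < β) (hirr : Irrational (α / β)) (k : ℕ) :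
    Irrational (anthGamma α β k / anthGamma α β (k + 1)) := by
  induction k with
  | zero =>
    simp only [anthGamma, zero_add]
    rw [anth_step α β hβ.ne']
    exact irr_inv_fract _ hirr
  | succ k ih =>
    have hb : anthGamma α β (k + 1) ≠ 0 := by
      intro h
      rw [h, div_zero] at ih
      exact ih.ne_zero rfl
    rw [show k + 1 + 1 = k + 2 from rfl, anthGamma, anth_step _ _ hb]
    exact irr_inv_fract _ ih

theorem anth_succ (α β : ℝ) (hβ : 0 < β) (hirr : Irrational (α / β)) (k : ℕ) :
    anthGamma α β (k + 1) / anthGamma α β (k + 2) =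
      (anthGamma α β k / anthGamma α β (k + 1)
        - ⌊anthGamma α β k / anthGamma α β (k + 1)⌋)⁻¹ := by
  have ih := anth_irr α β hβ hirr k
  have hb : anthGamma α β (k + 1) ≠ 0 := by
    intro h
    rw [h, div_zero] at ih
    exact ih.ne_zero rfl
  rw [anthGamma, anth_step _ _ hb]

theorem incremental_logos_criterion (α β : ℝ) (hβ : 0 < β) (hαβ : β < α)
    (hirr : Irrational (α / β)) (n m : ℕ) (hn : 1 ≤ n) (hnm : n < m)
    (hphi : anthPhi α β n = anthPhi α β m) :
    ∀ k, n ≤ k → anthI α β (k + (m - n)) = anthI α β k := by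
  obtain ⟨n, rfl⟩ : ∃ t, n = t + 1 := ⟨n - 1, by omega⟩
  obtain ⟨d, rfl⟩ : ∃ d, m = n + d + 1 := ⟨m - n - 1, by omega⟩
  have hd : n + d + 1 - (n + 1) = d := by omega
  rw [hd]
  simp only [anthPhi, Nat.add_sub_cancel, mul_div_assoc] at hphi
  have h0 := mul_left_cancel₀ hβ.ne' hphi
  have key : ∀ j, anthGamma α β (n + j + d) / anthGamma α β (n + j + d + 1) =
      anthGamma α β (n + j) / anthGamma α β (n + j + 1) := by
    intro j
    induction j with
    | zero =>
      rw [← inv_inj, inv_div, inv_div]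
      exact h0.symm
    | succ j ih =>
      have e : n + (j + 1) + d = n + j + d + 1 := by omega
      rw [e]
      have h1 := anth_succ α β hβ hirr (n + j + d)
      have h2 := anth_succ α β hβ hirr (n + j)
      rw [ih] at h1
      exact h1.trans h2.symm
  intro k hk
  obtain ⟨j, rfl⟩ : ∃ j, k = n + j + 1 := ⟨k - n - 1, by omega⟩
  have e : n + j + 1 + d = n + j + d + 1 := by omega
  rw [e, anthI, anthI, key j]
end

section
/- (Periodicity Theorem, structure of the increment factors.) Let N ≥ 2 be a positive integer that is not a perfect square, with anthyphairesis quotients (I_n) and increment factors (φ_n) of (√N, 1). Then there exist sequences (λ_k)_{k≥1} and (μ_k)_{k≥1} of positive integers with λ_1 = 1 and μ_1 = ⌊√N⌋ such that for all k ≥ 2: (a) λ_k·λ_{k−1} = N − μ_{k−1}², (c) μ_k + μ_{k−1} = I_{k−1}·λ_k, and (d) λ_k·φ_k = √N − μ_k; moreover λ_k < N and μ_k² < N for all k ≥ 1. -/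
noncomputable def lmSeq (N : ℕ) : ℕ → ℤ × ℤ
  | 0 => (1, ⌊Real.sqrt (N : ℝ)⌋)
  | n + 1 => (((N : ℤ) - (lmSeq N n).2 ^ 2) / (lmSeq N n).1,
      anthI (Real.sqrt (N : ℝ)) 1 (n + 1) * (((N : ℤ) - (lmSeq N n).2 ^ 2) / (lmSeq N n).1)
        - (lmSeq N n).2)

theorem lm_step (s g0 g1 : ℝ) (N l m l' I m' : ℤ) (hs : 0 < s) (hsN : s ^ 2 = N)
    (hirr : ∀ z : ℤ, s ≠ z)
    (hl : 0 < l) (hm : 0 < m) (h0 : 0 < g0) (h1 : 0 < g1) (h10 : g1 < g0)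
    (he : (l : ℝ) * g1 = (s - m) * g0) (hl' : l' * l = N - m ^ 2)
    (hI : I = ⌊g0 / g1⌋) (hm' : m' = I * l' - m) :
    0 < l' ∧ 0 < m' ∧ 0 < g0 - I * g1 ∧ g0 - I * g1 < g1 ∧
      (l' : ℝ) * (g0 - I * g1) = (s - m') * g1 ∧ l' ∣ N - m' ^ 2 := by
  have hlR : (0 : ℝ) < l := by exact_mod_cast hl
  have hmR : (0 : ℝ) < m := by exact_mod_cast hm
  have hsm : 0 < s - m := by
    have : 0 < (s - m) * g0 := by rw [← he]; positivity
    exact pos_of_mul_pos_left this h0.le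
  have hl'R : (l' : ℝ) * l = (s - m) * (s + m) := by
    have : (l' : ℝ) * l = N - m ^ 2 := by exact_mod_cast hl'
    rw [this, ← hsN]; ring
  have hl'pR : (0 : ℝ) < l' := by
    have : 0 < (l' : ℝ) * l := by rw [hl'R]; positivity
    exact pos_of_mul_pos_left this hlR.le
  have hl'p : 0 < l' := by exact_mod_cast hl'pR
  have key : (l' : ℝ) * g0 = (s + m) * g1 := by
    apply mul_left_cancel₀ hlR.ne'
    linear_combination g0 * hl'R - (s + m) * he
  have hIle : (I : ℝ) * g1 ≤ g0 := by
    have := Int.floor_le (g0 / g1)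
    rw [← hI] at this
    exact (le_div_iff₀ h1).1 this
  have hIlt : g0 < ((I : ℝ) + 1) * g1 := by
    have := Int.lt_floor_add_one (g0 / g1)
    rw [← hI] at this
    exact (div_lt_iff₀ h1).1 this
  have hI1 : 1 ≤ I := by
    rw [hI, Int.le_floor, le_div_iff₀ h1]
    push_cast; linarith
  have hm'R : (m' : ℝ) = I * l' - m := by exact_mod_cast hm'
  have e2 : (l' : ℝ) * (g0 - I * g1) = (s - m') * g1 := by
    rw [hm'R]; linear_combination key
  have hne : g0 - I * g1 ≠ 0 := by
    intro h
    rw [h, mul_zero] at e2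
    rcases mul_eq_zero.1 e2.symm with h | h
    · exact hirr m' (by linarith)
    · exact h1.ne' h
  have hlt : g0 - I * g1 < g1 := by linarith
  refine ⟨hl'p, ?_, lt_of_le_of_ne (by linarith) hne.symm, hlt, e2, ?_⟩
  · have h3 : s - m' < l' := by
      have : (s - m') * g1 < l' * g1 := by rw [← e2]; exact mul_lt_mul_of_pos_left hlt hl'pR
      exact lt_of_mul_lt_mul_right this h1.le
    rcases lt_or_ge (l' : ℝ) s with h | h
    · have : (0 : ℝ) < m' := by linarith
      exact_mod_cast this
    · have : (m : ℝ) < l' := by linarith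
      have : m < l' := by exact_mod_cast this
      rw [hm']; nlinarith
  · refine ⟨l - I ^ 2 * l' + 2 * I * m, ?_⟩
    rw [hm']; linear_combination -hl'

theorem lm_inv (N : ℕ) (hN : 2 ≤ N) (hsq : ¬ IsSquare N) (n : ℕ) :
    0 < (lmSeq N n).1 ∧ 0 < (lmSeq N n).2 ∧ 0 < anthGamma (Real.sqrt N) 1 n ∧
    0 < anthGamma (Real.sqrt N) 1 (n + 1) ∧
    anthGamma (Real.sqrt N) 1 (n + 1) < anthGamma (Real.sqrt N) 1 n ∧
    ((lmSeq N n).1 : ℝ) * anthGamma (Real.sqrt N) 1 (n + 1)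
      = (Real.sqrt N - (lmSeq N n).2) * anthGamma (Real.sqrt N) 1 n ∧
    (lmSeq N n).1 ∣ (N : ℤ) - (lmSeq N n).2 ^ 2 := by
  have hirr : ∀ z : ℤ, Real.sqrt N ≠ z := by
    intro z
    exact (irrational_sqrt_natCast_iff.2 hsq).ne_int z
  have hs : 1 ≤ Real.sqrt N := by
    rw [Real.one_le_sqrt]; exact_mod_cast (by omega : 1 ≤ N)
  induction n with
  | zero =>
    have h1 := Int.floor_le (Real.sqrt N)
    have h2 := Int.lt_floor_add_one (Real.sqrt N)
    have h3 := lt_of_le_of_ne h1 (hirr _).symm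
    have h4 : 0 < ⌊Real.sqrt (N : ℝ)⌋ := Int.floor_pos.2 hs
    simp only [lmSeq, anthGamma, div_one, mul_one]
    refine ⟨by norm_num, h4, by norm_num, by linarith, by linarith, by push_cast; ring, one_dvd _⟩
  | succ n ih =>
    obtain ⟨a, b, c, d, e, f, g⟩ := ih
    have := lm_step (Real.sqrt N) _ _ N _ _ (lmSeq N (n+1)).1 (anthI (Real.sqrt N) 1 (n+1))
      (lmSeq N (n+1)).2 (by linarith) (by rw [Real.sq_sqrt (by positivity)]; simp) hirr a b c d e f
      (Int.ediv_mul_cancel g) rfl rfl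
    obtain ⟨p, q, r, s, t, u⟩ := this
    exact ⟨p, q, d, r, s, t, u⟩

theorem periodicity_theorem_increment_structure (N : ℕ) (hN : 2 ≤ N) (hsq : ¬ IsSquare N) :
    ∃ lam mu : ℕ → ℤ,
      (∀ k, 1 ≤ k → 0 < lam k ∧ 0 < mu k) ∧
      lam 1 = 1 ∧ mu 1 = ⌊Real.sqrt (N : ℝ)⌋ ∧
      (∀ k, 2 ≤ k →
        lam k * lam (k - 1) = (N : ℤ) - mu (k - 1) ^ 2 ∧
        mu k + mu (k - 1) = anthI (Real.sqrt (N : ℝ)) 1 (k - 1) * lam k ∧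
        (lam k : ℝ) * anthPhi (Real.sqrt (N : ℝ)) 1 k = Real.sqrt (N : ℝ) - (mu k : ℝ)) ∧
      (∀ k, 1 ≤ k → lam k < (N : ℤ) ∧ mu k ^ 2 < (N : ℤ)) := by
  refine ⟨fun k => (lmSeq N (k - 1)).1, fun k => (lmSeq N (k - 1)).2, ?_, rfl, rfl, ?_, ?_⟩
  · intro k _
    have := lm_inv N hN hsq (k - 1)
    exact ⟨this.1, this.2.1⟩
  · intro k hk
    obtain ⟨n, rfl⟩ := Nat.exists_eq_add_of_le' hk
    obtain ⟨a, b, c, d, e, f, g⟩ := lm_inv N hN hsq n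
    obtain ⟨a', b', c', d', e', f', g'⟩ := lm_inv N hN hsq (n + 1)
    refine ⟨Int.ediv_mul_cancel g, ?_, ?_⟩
    · change (lmSeq N (n + 1)).2 + (lmSeq N n).2 = anthI (Real.sqrt N) 1 (n + 1) * (lmSeq N (n + 1)).1
      simp only [lmSeq]; ring
    · change ((lmSeq N (n + 1)).1 : ℝ) * (1 * anthGamma (Real.sqrt N) 1 (n + 2) /
        anthGamma (Real.sqrt N) 1 (n + 1)) = Real.sqrt N - (lmSeq N (n + 1)).2
      rw [one_mul, ← mul_div_assoc, div_eq_iff c'.ne']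
      exact f'
  · intro k _
    obtain ⟨a, b, c, d, e, f, g⟩ := lm_inv N hN hsq (k - 1)
    have haR : (0 : ℝ) < (lmSeq N (k - 1)).1 := by exact_mod_cast a
    have hbR : (0 : ℝ) < (lmSeq N (k - 1)).2 := by exact_mod_cast b
    have hsm : 0 < Real.sqrt N - (lmSeq N (k - 1)).2 := by
      have : 0 < (Real.sqrt N - (lmSeq N (k - 1)).2) * anthGamma (Real.sqrt N) 1 (k - 1) := by
        rw [← f]; positivity
      exact pos_of_mul_pos_left this c.le
    have h2 : (lmSeq N (k - 1)).2 ^ 2 < (N : ℤ) := by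
      have : ((lmSeq N (k - 1)).2 : ℝ) ^ 2 < N := by
        have h := Real.sq_sqrt (Nat.cast_nonneg (α := ℝ) N)
        nlinarith
      exact_mod_cast this
    refine ⟨?_, h2⟩
    have h3 := Int.le_of_dvd (by linarith) g
    have h4 : 0 < (lmSeq N (k - 1)).2 ^ 2 := by positivity
    show (lmSeq N (k - 1)).1 < (N : ℤ)
    linarith
end

section
/- (Properties of the conjugate inverses ω_n.) Let N ≥ 2 be a non-square positive integer, with anthyphairesis quotients (I_n), increment factors (φ_n) of (√N, 1), and sequences (λ_k), (μ_k), (ω_n) as in the context. Then for every n ≥ 1: (a) λ_{n+1}·ω_n = √N − μ_n, (b) 0 < ω_n < 1, (c) ω_1·(φ_1 + 2μ_1) = 1, and (d) ω_{n+1}·(I_n + ω_n) = 1. -/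
/-- The conjugate inverses `ω n = λ n / (√N + μ n)`. -/
noncomputable def omegaSeq (N : ℕ) (lam mu : ℕ → ℤ) (n : ℕ) : ℝ :=
  (lam n : ℝ) / (Real.sqrt (N : ℝ) + (mu n : ℝ))

theorem omega_properties (N : ℕ) (hN : 2 ≤ N) (hsq : ¬ IsSquare N)
    (lam mu : ℕ → ℤ)
    (hpos : ∀ k, 1 ≤ k → 0 < lam k ∧ 0 < mu k)
    (hlam1 : lam 1 = 1) (hmu1 : mu 1 = ⌊Real.sqrt (N : ℝ)⌋)
    (hphi : ∀ k, 1 ≤ k →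
      (lam k : ℝ) * anthPhi (Real.sqrt (N : ℝ)) 1 k = Real.sqrt (N : ℝ) - (mu k : ℝ))
    (hlamlam : ∀ k, 1 ≤ k → lam (k + 1) * lam k = (N : ℤ) - mu k ^ 2)
    (hmuI : ∀ k, 2 ≤ k →
      mu k + mu (k - 1) = anthI (Real.sqrt (N : ℝ)) 1 (k - 1) * lam k) :
    (∀ n, 1 ≤ n →
      (lam (n + 1) : ℝ) * omegaSeq N lam mu n = Real.sqrt (N : ℝ) - (mu n : ℝ) ∧
      (0 < omegaSeq N lam mu n ∧ omegaSeq N lam mu n < 1) ∧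
      omegaSeq N lam mu (n + 1) * ((anthI (Real.sqrt (N : ℝ)) 1 n : ℝ) + omegaSeq N lam mu n) = 1) ∧
    omegaSeq N lam mu 1 * (anthPhi (Real.sqrt (N : ℝ)) 1 1 + 2 * (mu 1 : ℝ)) = 1 := by
  have hNr : (0:ℝ) < N := by exact_mod_cast (by omega : 0 < N)
  have hs : 0 < Real.sqrt (N : ℝ) := Real.sqrt_pos.mpr hNr
  have hss : Real.sqrt (N : ℝ) * Real.sqrt (N : ℝ) = N := Real.mul_self_sqrt hNr.le
  have hl : ∀ k, 1 ≤ k → (0:ℝ) < lam k := fun k hk => by exact_mod_cast (hpos k hk).1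
  have hm : ∀ k, 1 ≤ k → (0:ℝ) < mu k := fun k hk => by exact_mod_cast (hpos k hk).2
  have hom : ∀ k, 1 ≤ k →
      omegaSeq N lam mu k * (Real.sqrt (N : ℝ) + mu k) = lam k := fun k hk => by
    have := hm k hk
    unfold omegaSeq
    exact div_mul_cancel₀ _ (by positivity)
  have hop : ∀ k, 1 ≤ k → 0 < omegaSeq N lam mu k := fun k hk =>
    div_pos (hl k hk) (add_pos hs (hm k hk))
  have ha : ∀ n, 1 ≤ n →
      (lam (n + 1) : ℝ) * omegaSeq N lam mu n = Real.sqrt (N : ℝ) - (mu n : ℝ) := by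
    intro n hn
    have h1 : (lam (n + 1) : ℝ) * lam n = N - (mu n : ℝ) ^ 2 := by
      exact_mod_cast hlamlam n hn
    have h2 := hom n hn
    have h3 : 0 < Real.sqrt (N : ℝ) + mu n := add_pos hs (hm n hn)
    apply mul_right_cancel₀ h3.ne'
    rw [mul_assoc, h2, h1]
    linear_combination -hss
  have hmI : ∀ n, 1 ≤ n →
      (mu (n + 1) : ℝ) + mu n = (anthI (Real.sqrt (N : ℝ)) 1 n : ℝ) * lam (n + 1) := by
    intro n hn
    have := hmuI (n + 1) (by omega)
    rw [Nat.add_sub_cancel] at this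
    exact_mod_cast this
  have hd : ∀ n, 1 ≤ n → omegaSeq N lam mu (n + 1) *
      ((anthI (Real.sqrt (N : ℝ)) 1 n : ℝ) + omegaSeq N lam mu n) = 1 := by
    intro n hn
    apply mul_left_cancel₀ (hl (n + 1) (by omega)).ne'
    linear_combination omegaSeq N lam mu (n + 1) * (ha n hn) -
      omegaSeq N lam mu (n + 1) * (hmI n hn) + hom (n + 1) (by omega)
  have hI : ∀ n, 1 ≤ n → (1:ℝ) ≤ (anthI (Real.sqrt (N : ℝ)) 1 n : ℝ) := by
    intro n hn
    have h1 : (0:ℝ) < (anthI (Real.sqrt (N : ℝ)) 1 n : ℝ) := by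
      apply pos_of_mul_pos_left _ (hl (n + 1) (by omega)).le
      rw [← hmI n hn]
      exact add_pos (hm _ (by omega)) (hm _ hn)
    have h2 : 0 < anthI (Real.sqrt (N : ℝ)) 1 n := by exact_mod_cast h1
    exact_mod_cast h2
  have h1 := hom 1 le_rfl
  rw [hlam1] at h1
  push_cast at h1
  refine ⟨fun n hn => ⟨ha n hn, ⟨hop n hn, ?_⟩, hd n hn⟩, ?_⟩
  · obtain rfl | hn2 := eq_or_lt_of_le hn
    · have h2 : (1:ℝ) ≤ mu 1 := by exact_mod_cast (hpos 1 le_rfl).2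
      have h3 := hop 1 le_rfl
      nlinarith [mul_pos h3 hs]
    · obtain ⟨m, rfl⟩ : ∃ m, n = m + 1 := ⟨n - 1, by omega⟩
      have hm1 : 1 ≤ m := by omega
      nlinarith [hd m hm1, mul_pos (hop (m + 1) hn) (hop m hm1),
        mul_le_mul_of_nonneg_left (hI m hm1) (hop (m + 1) hn).le]
  · have h2 := hphi 1 le_rfl
    rw [hlam1] at h2
    push_cast at h2
    linear_combination omegaSeq N lam mu 1 * h2 + h1
end

section
/- (Pigeonhole coincidence of increment factors.) Let N ≥ 2 be a positive integer that is not a perfect square, with increment factors (φ_n) of the anthyphairesis of (√N, 1). Then the set of values {φ_n : n ≥ 1} is finite; in particular there exist indices 1 ≤ n < m with φ_n = φ_m. -/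
def AnthInv (s : ℝ) (N : ℕ) (n : ℕ) : Prop :=
  ∃ P Q R : ℤ, Q * R = (N : ℤ) - P ^ 2 ∧ 0 < Q ∧ (P : ℝ) < s ∧ s - P < Q ∧ (Q : ℝ) < s + P ∧
    0 < anthGamma s 1 n ∧ anthGamma s 1 (n + 1) * Q = anthGamma s 1 n * (s - P)

theorem anthInv_all (s : ℝ) (N : ℕ) (hs : s ^ 2 = N) (h1 : 1 < s)
    (hirr : ∀ z : ℤ, (z : ℝ) ≠ s) (n : ℕ) : AnthInv s N n := by
  induction n with
  | zero =>
    have hf1 := Int.floor_le s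
    have hf2 := Int.lt_floor_add_one s
    have hI : (1 : ℤ) ≤ ⌊s⌋ := Int.le_floor.mpr (by exact_mod_cast h1.le)
    have hI' : (1 : ℝ) ≤ (⌊s⌋ : ℝ) := by exact_mod_cast hI
    refine ⟨⌊s⌋, 1, (N : ℤ) - ⌊s⌋ ^ 2, by ring, one_pos, lt_of_le_of_ne hf1 (hirr _), ?_, ?_, ?_, ?_⟩
    · push_cast; linarith
    · push_cast; linarith
    · simp [anthGamma]
    · simp [anthGamma]
  | succ n ih =>
    obtain ⟨P, Q, R, hQR, hQ, hP, hlt, hgt, hg, heq⟩ := ih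
    have hQ' : (0 : ℝ) < Q := by exact_mod_cast hQ
    have hQR' : (Q : ℝ) * R = s ^ 2 - P ^ 2 := by rw [hs]; exact_mod_cast hQR
    have hsP : 0 < s - P := by linarith
    have hR' : (0 : ℝ) < R := by
      have : (0 : ℝ) < Q * R := by rw [hQR']; nlinarith
      exact pos_of_mul_pos_right this hQ'.le
    have hR : 0 < R := by exact_mod_cast hR'
    have hg1 : 0 < anthGamma s 1 (n + 1) := by
      have : 0 < anthGamma s 1 (n + 1) * Q := by rw [heq]; positivity
      exact pos_of_mul_pos_left this hQ'.le
    have hkey : anthGamma s 1 n * R = anthGamma s 1 (n + 1) * (s + P) := by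
      apply mul_left_cancel₀ hQ'.ne'
      linear_combination anthGamma s 1 n * hQR' - (s + P) * heq
    have hdiv : anthGamma s 1 n / anthGamma s 1 (n + 1) = (s + P) / R := by
      rw [div_eq_div_iff hg1.ne' hR'.ne']; linear_combination hkey
    have hrec : anthGamma s 1 (n + 1 + 1) =
        anthGamma s 1 n - ⌊(s + P) / R⌋ * anthGamma s 1 (n + 1) := by
      rw [← hdiv]; simp [anthGamma]
    have hI : (1 : ℤ) ≤ ⌊(s + P) / R⌋ := by
      rw [Int.le_floor, le_div_iff₀ hR']
      push_cast
      have : (s - P) * R ≤ (s - P) * (s + P) := by nlinarith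
      have := le_of_mul_le_mul_left this hsP
      linarith
    have hf1 := Int.floor_le ((s + P) / R)
    have hf2 := Int.lt_floor_add_one ((s + P) / R)
    rw [le_div_iff₀ hR'] at hf1
    rw [div_lt_iff₀ hR'] at hf2
    generalize ⌊(s + P) / R⌋ = I at *
    have hI' : (1 : ℝ) ≤ I := by exact_mod_cast hI
    refine ⟨I * R - P, R, Q + 2 * I * P - I ^ 2 * R, ?_, hR, lt_of_le_of_ne ?_ (hirr _), ?_, ?_, hg1, ?_⟩
    · linear_combination hQR
    · push_cast; linarith
    · push_cast; linarith
    · push_cast; nlinarith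
    · rw [hrec]; push_cast; linear_combination hkey

theorem pigeonhole_increment_factors (N : ℕ) (hN : 2 ≤ N) (hsq : ¬ IsSquare N) :
    Set.Finite {x : ℝ | ∃ n, 1 ≤ n ∧ anthPhi (Real.sqrt (N : ℝ)) 1 n = x} ∧
    ∃ n m : ℕ, 1 ≤ n ∧ n < m ∧
      anthPhi (Real.sqrt (N : ℝ)) 1 n = anthPhi (Real.sqrt (N : ℝ)) 1 m := by
  have hs : (Real.sqrt (N : ℝ)) ^ 2 = N := Real.sq_sqrt (Nat.cast_nonneg N)
  have h1 : 1 < Real.sqrt (N : ℝ) := by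
    rw [Real.lt_sqrt zero_le_one]
    have : (2 : ℝ) ≤ N := by exact_mod_cast hN
    linarith
  have hirr : ∀ z : ℤ, (z : ℝ) ≠ Real.sqrt (N : ℝ) := by
    intro z hz
    rw [← hz] at hs
    have h : z ^ 2 = (N : ℤ) := by exact_mod_cast hs
    apply hsq
    refine ⟨z.natAbs, ?_⟩
    zify
    rw [← h, abs_mul_abs_self, sq]
  generalize Real.sqrt (N : ℝ) = s at *
  have hfin : Set.Finite {x : ℝ | ∃ n, 1 ≤ n ∧ anthPhi s 1 n = x} := by
    refine ((((Set.finite_Icc (0 : ℤ) ⌈s⌉).prod (Set.finite_Icc (0 : ℤ) ⌈2 * s⌉))).image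
      (fun p : ℤ × ℤ => (s - p.1) / p.2)).subset ?_
    rintro x ⟨n, hn, rfl⟩
    obtain ⟨k, rfl⟩ : ∃ k, n = k + 1 := ⟨n - 1, by omega⟩
    obtain ⟨P, Q, R, hQR, hQ, hP, hlt, hgt, hg, heq⟩ := anthInv_all s N hs h1 hirr k
    have hQ' : (0 : ℝ) < Q := by exact_mod_cast hQ
    have c1 := Int.le_ceil s
    have c2 := Int.le_ceil (2 * s)
    refine ⟨(P, Q), ⟨⟨?_, ?_⟩, ⟨hQ.le, ?_⟩⟩, ?_⟩
    · have : (0 : ℝ) ≤ P := by linarith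
      exact_mod_cast this
    · have : (P : ℝ) ≤ ⌈s⌉ := by linarith
      exact_mod_cast this
    · have : (Q : ℝ) ≤ ⌈2 * s⌉ := by linarith
      exact_mod_cast this
    · simp only [anthPhi, Nat.add_sub_cancel, one_mul]
      rw [div_eq_div_iff hQ'.ne' hg.ne']
      linear_combination -heq
  refine ⟨hfin, ?_⟩
  have hmaps : ∀ k : ℕ, anthPhi s 1 (k + 1) ∈ {x : ℝ | ∃ n, 1 ≤ n ∧ anthPhi s 1 n = x} :=
    fun k => ⟨k + 1, by omega, rfl⟩
  obtain ⟨a, b, hab, h⟩ := Set.Finite.exists_lt_map_eq_of_forall_mem hmaps hfin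
  exact ⟨a + 1, b + 1, by omega, by omega, h⟩
end

section
/- (Palindromic propagation step.) Let N ≥ 2 be a non-square positive integer, with anthyphairesis quotients (I_n), increment factors (φ_n) of (√N, 1), and sequences (λ_k), (μ_k), (ω_n) as in the context. If k ≥ 1 and j ≥ 2 are indices with φ_k = ω_j, then I_k = I_{j−1} and φ_{k+1} = ω_{j−1}. -/
theorem palindromic_propagation_step (N : ℕ) (hN : 2 ≤ N) (hsq : ¬ IsSquare N)
    (lam mu : ℕ → ℤ)
    (hpos : ∀ k, 1 ≤ k → 0 < lam k ∧ 0 < mu k)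
    (hlam1 : lam 1 = 1) (hmu1 : mu 1 = ⌊Real.sqrt (N : ℝ)⌋)
    (hphi : ∀ k, 1 ≤ k →
      (lam k : ℝ) * anthPhi (Real.sqrt (N : ℝ)) 1 k = Real.sqrt (N : ℝ) - (mu k : ℝ))
    (hlamlam : ∀ k, 1 ≤ k → lam (k + 1) * lam k = (N : ℤ) - mu k ^ 2)
    (hmuI : ∀ k, 2 ≤ k →
      mu k + mu (k - 1) = anthI (Real.sqrt (N : ℝ)) 1 (k - 1) * lam k)
    (k j : ℕ) (hk : 1 ≤ k) (hj : 2 ≤ j)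
    (h : anthPhi (Real.sqrt (N : ℝ)) 1 k = omegaSeq N lam mu j) :
    anthI (Real.sqrt (N : ℝ)) 1 k = anthI (Real.sqrt (N : ℝ)) 1 (j - 1) ∧
    anthPhi (Real.sqrt (N : ℝ)) 1 (k + 1) = omegaSeq N lam mu (j - 1) := by
  have hs2 : Real.sqrt (N : ℝ) ^ 2 = N := Real.sq_sqrt (by positivity)
  have hs0 : 1 ≤ Real.sqrt (N : ℝ) := by
    rw [Real.one_le_sqrt]
    exact_mod_cast (by omega : 1 ≤ N)
  have hl : ∀ m, 1 ≤ m → (0 : ℝ) < lam m := fun m hm => by exact_mod_cast (hpos m hm).1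
  have hm : ∀ m, 1 ≤ m → (1 : ℝ) ≤ mu m := fun m hm => by
    have := (hpos m hm).2
    exact_mod_cast this
  have hω : ∀ m, 1 ≤ m → 0 < omegaSeq N lam mu m := by
    intro m h1
    have := hl m h1
    have := hm m h1
    unfold omegaSeq
    positivity
  have hI : ∀ m, 1 ≤ m → (1 : ℝ) ≤ anthI (Real.sqrt (N : ℝ)) 1 m := by
    intro m h1
    have e := hmuI (m + 1) (by omega)
    simp only [Nat.add_sub_cancel] at e
    have a := hpos m h1
    have b := hpos (m + 1) (by omega)
    have : 0 < anthI (Real.sqrt (N : ℝ)) 1 m := by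
      by_contra hc
      nlinarith
    exact_mod_cast this
  have hrec : ∀ m, 1 ≤ m → (omegaSeq N lam mu (m + 1))⁻¹
      = anthI (Real.sqrt (N : ℝ)) 1 m + omegaSeq N lam mu m := by
    intro m h1
    have e := hmuI (m + 1) (by omega)
    simp only [Nat.add_sub_cancel] at e
    have e' : (mu (m + 1) : ℝ) + mu m = anthI (Real.sqrt (N : ℝ)) 1 m * lam (m + 1) := by
      exact_mod_cast e
    have f : (lam (m + 1) : ℝ) * lam m = N - (mu m : ℝ) ^ 2 := by
      exact_mod_cast hlamlam m h1
    have l1 := hl (m + 1) (by omega)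
    have m0 := hm m h1
    have hd : Real.sqrt (N : ℝ) + mu m ≠ 0 := by positivity
    unfold omegaSeq
    rw [inv_div, div_eq_iff l1.ne', add_mul, ← e', div_mul_eq_mul_div, mul_comm (lam m : ℝ), f,
      show (N : ℝ) - (mu m : ℝ) ^ 2
        = (Real.sqrt (N : ℝ) - mu m) * (Real.sqrt (N : ℝ) + mu m) by linear_combination -hs2,
      mul_div_assoc, div_self hd]
    ring
  have hlt : ∀ m, 1 ≤ m → omegaSeq N lam mu m < 1 := by
    intro m h1
    obtain rfl | h2 := Nat.eq_or_lt_of_le h1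
    · have := hm 1 le_rfl
      unfold omegaSeq
      rw [hlam1, div_lt_one (by positivity)]
      push_cast
      linarith
    · obtain ⟨n, rfl⟩ : ∃ n, m = n + 1 := ⟨m - 1, by omega⟩
      have a := hrec n (by omega)
      have b := hI n (by omega)
      have c := hω n (by omega)
      have d := hω (n + 1) h1
      exact (one_lt_inv₀ d).1 (by linarith)
  obtain ⟨n, rfl⟩ : ∃ n, k = n + 1 := ⟨k - 1, by omega⟩
  obtain ⟨m, rfl⟩ : ∃ m, j = m + 1 := ⟨j - 1, by omega⟩
  have h1 : 1 ≤ m := by omega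
  have hr := hrec m h1
  have hp := hω (m + 1) (by omega)
  rw [← h] at hr hp
  simp only [Nat.add_sub_cancel]
  simp only [anthPhi, Nat.add_sub_cancel, one_mul] at hr hp ⊢
  rw [inv_div] at hr
  have hg : anthGamma (Real.sqrt (N : ℝ)) 1 (n + 1) ≠ 0 := by
    intro h0
    simp [h0] at hp
  have hfl : anthI (Real.sqrt (N : ℝ)) 1 (n + 1) = anthI (Real.sqrt (N : ℝ)) 1 m := by
    have e : anthI (Real.sqrt (N : ℝ)) 1 (n + 1) = ⌊anthGamma (Real.sqrt (N : ℝ)) 1 n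
      / anthGamma (Real.sqrt (N : ℝ)) 1 (n + 1)⌋ := rfl
    rw [e, hr, Int.floor_eq_iff]
    have := hω m h1
    have := hlt m h1
    constructor <;> linarith
  refine ⟨hfl, ?_⟩
  have e : anthGamma (Real.sqrt (N : ℝ)) 1 (n + 1 + 1) = anthGamma (Real.sqrt (N : ℝ)) 1 n
      - anthI (Real.sqrt (N : ℝ)) 1 (n + 1) * anthGamma (Real.sqrt (N : ℝ)) 1 (n + 1) := by
    rw [anthGamma, anthI]
  rw [e, hfl, sub_div, hr, mul_div_assoc, div_self hg]
  ring
end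

section
/- (Backward propagation of coincidences.) Let N ≥ 2 be a non-square positive integer, with anthyphairesis quotients (I_n), increment factors (φ_n) of (√N, 1), and sequences (λ_k), (μ_k), (ω_n) as in the context. If 2 ≤ j < k are indices with φ_k = φ_j, then ω_k = ω_j, I_{k−1} = I_{j−1}, and ω_{k−1} = ω_{j−1}. -/
theorem backward_propagation_of_coincidences (N : ℕ) (hN : 2 ≤ N) (hsq : ¬ IsSquare N)
    (lam mu : ℕ → ℤ)
    (hpos : ∀ k, 1 ≤ k → 0 < lam k ∧ 0 < mu k)
    (hlam1 : lam 1 = 1) (hmu1 : mu 1 = ⌊Real.sqrt (N : ℝ)⌋)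
    (hphi : ∀ k, 1 ≤ k →
      (lam k : ℝ) * anthPhi (Real.sqrt (N : ℝ)) 1 k = Real.sqrt (N : ℝ) - (mu k : ℝ))
    (hlamlam : ∀ k, 1 ≤ k → lam (k + 1) * lam k = (N : ℤ) - mu k ^ 2)
    (hmuI : ∀ k, 2 ≤ k →
      mu k + mu (k - 1) = anthI (Real.sqrt (N : ℝ)) 1 (k - 1) * lam k)
    (j k : ℕ) (hj : 2 ≤ j) (hjk : j < k)
    (h : anthPhi (Real.sqrt (N : ℝ)) 1 k = anthPhi (Real.sqrt (N : ℝ)) 1 j) :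
    omegaSeq N lam mu k = omegaSeq N lam mu j ∧
    anthI (Real.sqrt (N : ℝ)) 1 (k - 1) = anthI (Real.sqrt (N : ℝ)) 1 (j - 1) ∧
    omegaSeq N lam mu (k - 1) = omegaSeq N lam mu (j - 1) := by
  set s := Real.sqrt (N : ℝ) with hs
  have hirr : Irrational s := by
    rw [hs]; exact irrational_sqrt_natCast_iff.mpr hsq
  have hs2 : s * s = (N : ℝ) := Real.mul_self_sqrt (Nat.cast_nonneg N)
  have hs0 : 0 ≤ s := Real.sqrt_nonneg _
  have hL : ∀ n, 1 ≤ n → (0 : ℝ) < (lam n : ℝ) := fun n hn => by exact_mod_cast (hpos n hn).1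
  have hM : ∀ n, 1 ≤ n → (0 : ℝ) < (mu n : ℝ) := fun n hn => by exact_mod_cast (hpos n hn).2
  have hLL : ∀ n, 1 ≤ n → (lam (n + 1) : ℝ) * lam n = s * s - (mu n : ℝ) ^ 2 := by
    intro n hn
    rw [hs2]
    exact_mod_cast hlamlam n hn
  have hlt : ∀ n, 1 ≤ n → (mu n : ℝ) < s := by
    intro n hn
    have h1 := hLL n hn
    have h2 := mul_pos (hL (n + 1) (by omega)) (hL n hn)
    nlinarith [hM n hn]
  have hom0 : ∀ n, 1 ≤ n → 0 < omegaSeq N lam mu n := by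
    intro n hn
    unfold omegaSeq
    exact div_pos (hL n hn) (by linarith [hM n hn])
  have hom1 : ∀ n, 1 ≤ n → omegaSeq N lam mu n < 1 := by
    intro n hn
    unfold omegaSeq
    rw [← hs, div_lt_one (by linarith [hM n hn])]
    rcases Nat.eq_or_lt_of_le hn with h1 | h1
    · subst h1
      have h2 : (1 : ℝ) ≤ (mu 1 : ℝ) := by exact_mod_cast (hpos 1 le_rfl).2
      rw [hlam1]
      push_cast
      linarith [hlt 1 le_rfl]
    · have h2 := hmuI n h1
      have h3 := hpos n hn
      have h4 := hpos (n - 1) (by omega)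
      have h5 : lam n ≤ mu n + mu (n - 1) := by
        have h6 : 0 < anthI s 1 (n - 1) := by
          by_contra hc
          have := mul_nonpos_of_nonpos_of_nonneg (not_lt.mp hc) h3.1.le
          omega
        rw [h2]
        nlinarith
      have h7 : (lam n : ℝ) ≤ mu n + mu (n - 1) := by exact_mod_cast h5
      linarith [hlt (n - 1) (by omega)]
  have hstep : ∀ n, 2 ≤ n →
      1 / omegaSeq N lam mu n = anthI s 1 (n - 1) + omegaSeq N lam mu (n - 1) := by
    intro n hn
    obtain ⟨m, rfl⟩ : ∃ m, n = m + 1 := ⟨n - 1, by omega⟩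
    have h2 := hmuI (m + 1) hn
    simp only [Nat.add_sub_cancel] at h2 ⊢
    have h3 : (mu (m + 1) : ℝ) + mu m = anthI s 1 m * lam (m + 1) := by exact_mod_cast h2
    have h4 := hLL m (by omega)
    have h5 := hL (m + 1) (by omega)
    have h6 := hM m (by omega)
    have h7 : s + (mu m : ℝ) ≠ 0 := by linarith
    unfold omegaSeq
    rw [← hs, one_div_div, div_eq_iff h5.ne', add_mul, ← h3, div_mul_eq_mul_div, ← sub_eq_iff_eq_add',
      eq_div_iff h7]
    linarith
  have hk1 := hphi k (by omega)
  have hj1 := hphi j (by omega)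
  have hkL := hL k (by omega)
  have hjL := hL j (by omega)
  rw [h] at hk1
  have key : ((lam j : ℝ) - lam k) * s = lam j * mu k - lam k * mu j := by
    linear_combination (lam k : ℝ) * hj1 - (lam j : ℝ) * hk1
  have hlam : lam j = lam k := by
    by_contra hne
    have hne' : lam j - lam k ≠ 0 := sub_ne_zero.mpr hne
    have hI := hirr.intCast_mul hne'
    apply hI.ne_int (lam j * mu k - lam k * mu j)
    push_cast
    exact key
  have hmu : mu k = mu j := by
    rw [hlam] at hj1
    have : (mu k : ℝ) = mu j := by linarith
    exact_mod_cast this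
  have hom : omegaSeq N lam mu k = omegaSeq N lam mu j := by
    unfold omegaSeq
    rw [hlam, hmu]
  have e1 := hstep k (by omega)
  have e2 := hstep j hj
  rw [hom, e2] at e1
  have a1 := hom0 (k - 1) (by omega)
  have a2 := hom1 (k - 1) (by omega)
  have a3 := hom0 (j - 1) (by omega)
  have a4 := hom1 (j - 1) (by omega)
  have hI : anthI s 1 (k - 1) = anthI s 1 (j - 1) := by
    have b1 : (anthI s 1 (k - 1) : ℝ) < anthI s 1 (j - 1) + 1 := by linarith
    have b2 : (anthI s 1 (j - 1) : ℝ) < anthI s 1 (k - 1) + 1 := by linarith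
    have c1 : anthI s 1 (k - 1) < anthI s 1 (j - 1) + 1 := by exact_mod_cast b1
    have c2 : anthI s 1 (j - 1) < anthI s 1 (k - 1) + 1 := by exact_mod_cast b2
    omega
  refine ⟨hom, hI, ?_⟩
  rw [hI] at e1
  linarith
end

section
/- (Case I of the palindromicity proof.) Let N ≥ 2 be a non-square positive integer, with anthyphairesis quotients (I_n), increment factors (φ_n) of (√N, 1), and sequences (λ_k), (μ_k), (ω_n) as in the context. If k ≥ 2 is an index with φ_k = ω_{k−1}, then φ_{2k−1} = φ_1, I_{2k−2} = 2·μ_1, and I_j = I_{2k−2−j} for all j with 1 ≤ j ≤ 2k−3; consequently the anthyphairesis of (√N, 1) is periodic with palindromic period (I_1, …, I_{2k−3}, 2μ_1) of length 2k−2. -/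
theorem palindromicity_case_I (N : ℕ) (hN : 2 ≤ N) (hsq : ¬ IsSquare N)
    (lam mu : ℕ → ℤ)
    (hpos : ∀ k, 1 ≤ k → 0 < lam k ∧ 0 < mu k)
    (hlam1 : lam 1 = 1) (hmu1 : mu 1 = ⌊Real.sqrt (N : ℝ)⌋)
    (hphi : ∀ k, 1 ≤ k →
      (lam k : ℝ) * anthPhi (Real.sqrt (N : ℝ)) 1 k = Real.sqrt (N : ℝ) - (mu k : ℝ))
    (hlamlam : ∀ k, 1 ≤ k → lam (k + 1) * lam k = (N : ℤ) - mu k ^ 2)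
    (hmuI : ∀ k, 2 ≤ k →
      mu k + mu (k - 1) = anthI (Real.sqrt (N : ℝ)) 1 (k - 1) * lam k)
    (k : ℕ) (hk : 2 ≤ k)
    (h : anthPhi (Real.sqrt (N : ℝ)) 1 k = omegaSeq N lam mu (k - 1)) :
    anthPhi (Real.sqrt (N : ℝ)) 1 (2 * k - 1) = anthPhi (Real.sqrt (N : ℝ)) 1 1 ∧
    anthI (Real.sqrt (N : ℝ)) 1 (2 * k - 2) = 2 * mu 1 ∧
    (∀ j, 1 ≤ j → j ≤ 2 * k - 3 →
      anthI (Real.sqrt (N : ℝ)) 1 j = anthI (Real.sqrt (N : ℝ)) 1 (2 * k - 2 - j)) ∧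
    (∀ n, 1 ≤ n →
      anthI (Real.sqrt (N : ℝ)) 1 (n + (2 * k - 2)) = anthI (Real.sqrt (N : ℝ)) 1 n) := by
  set s := Real.sqrt (N : ℝ) with hs
  have hirr : Irrational s := by
    rw [hs, irrational_sqrt_natCast_iff]; exact hsq
  have hss : s ^ 2 = N := Real.sq_sqrt (Nat.cast_nonneg N)
  have hs0 : 0 ≤ s := Real.sqrt_nonneg _
  set φ := anthPhi s 1 with hφ
  set I := anthI s 1 with hI
  have hlp : ∀ n, 1 ≤ n → (0 : ℝ) < lam n := fun n hn => by exact_mod_cast (hpos n hn).1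
  have hmp : ∀ n, 1 ≤ n → (0 : ℝ) < mu n := fun n hn => by exact_mod_cast (hpos n hn).2
  have hφ0 : ∀ n, 1 ≤ n → φ n ≠ 0 := by
    intro n hn h0
    have h1 := hphi n hn
    rw [h0, mul_zero] at h1
    exact hirr.ne_int (mu n) (by linarith)
  have hdef : ∀ n, φ (n + 1) = anthGamma s 1 (n + 1) / anthGamma s 1 n := by
    intro n; simp [hφ, anthPhi]
  have hg : ∀ n, anthGamma s 1 n ≠ 0 := by
    intro n h0
    apply hφ0 (n + 1) (by omega)
    rw [hdef, h0, div_zero]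
  have hIf : ∀ n, 1 ≤ n → I n = ⌊(φ n)⁻¹⌋ := by
    intro n hn
    obtain ⟨m, rfl⟩ : ∃ m, n = m + 1 := ⟨n - 1, by omega⟩
    rw [hdef, inv_div]
    simp [hI, anthI]
  have hstep : ∀ n, 1 ≤ n → φ (n + 1) = Int.fract (φ n)⁻¹ := by
    intro n hn
    obtain ⟨m, rfl⟩ : ∃ m, n = m + 1 := ⟨n - 1, by omega⟩
    rw [hdef, hdef m, inv_div, Int.fract]
    have := hg (m + 1)
    have e : anthGamma s 1 (m + 1 + 1) = anthGamma s 1 m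
      - ⌊anthGamma s 1 m / anthGamma s 1 (m + 1)⌋ * anthGamma s 1 (m + 1) := by
      rw [anthGamma]
    rw [e, sub_div, mul_div_cancel_right₀ _ this]
  have hφ1 : φ 1 = Int.fract s := by
    have := hdef 0
    simp only [zero_add] at this
    rw [this]
    simp [anthGamma]
  have hφpos : ∀ n, 1 ≤ n → 0 < φ n ∧ φ n < 1 := by
    intro n hn
    have h0 := hφ0 n hn
    have : 0 ≤ φ n ∧ φ n < 1 := by
      rcases Nat.lt_or_ge n 2 with h2 | h2
      · obtain rfl : n = 1 := by omega
        rw [hφ1]; exact ⟨Int.fract_nonneg _, Int.fract_lt_one _⟩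
      · obtain ⟨m, rfl⟩ : ∃ m, n = m + 1 := ⟨n - 1, by omega⟩
        rw [hstep m (by omega)]; exact ⟨Int.fract_nonneg _, Int.fract_lt_one _⟩
    exact ⟨lt_of_le_of_ne this.1 (Ne.symm h0), this.2⟩
  have hI1 : ∀ n, 1 ≤ n → 1 ≤ I n := by
    intro n hn
    rw [hIf n hn, Int.le_floor]
    have := hφpos n hn
    simpa using (one_lt_inv₀ this.1).2 this.2 |>.le
  set ω := omegaSeq N lam mu with hω
  have hωdef : ∀ n, ω n = lam n / (s + mu n) := fun n => rfl
  have hωstep : ∀ n, 1 ≤ n → (ω (n + 1))⁻¹ = I n + ω n := by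
    intro n hn
    rw [hωdef, hωdef, inv_div]
    have a1 := hlp n hn
    have a2 := hlp (n + 1) (by omega)
    have a3 := hmp n hn
    have b1 : (lam (n + 1) : ℝ) * lam n = N - mu n ^ 2 := by exact_mod_cast hlamlam n hn
    have b2 : (mu (n + 1) : ℝ) + mu n = I n * lam (n + 1) := by
      have := hmuI (n + 1) (by omega)
      simp only [Nat.add_sub_cancel] at this
      exact_mod_cast this
    have a4 : s + mu n ≠ 0 := by positivity
    have c : (lam n : ℝ) / (s + mu n) = (s - mu n) / lam (n + 1) := by
      rw [div_eq_div_iff a4 a2.ne']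
      linear_combination b1 - hss
    rw [c, div_eq_iff a2.ne', add_mul, div_mul_cancel₀ _ a2.ne']
    linear_combination b2
  have hωpos : ∀ n, 1 ≤ n → 0 < ω n := by
    intro n hn
    have := hlp n hn
    have := hmp n hn
    rw [hωdef]; positivity
  have hs1 : 1 < s := by
    rw [hs, Real.lt_sqrt (by norm_num)]
    have : (2 : ℝ) ≤ N := by exact_mod_cast hN
    linarith
  have hω1 : ω 1 = (s + mu 1)⁻¹ := by rw [hωdef, hlam1]; simp
  have hωlt : ∀ n, 1 ≤ n → ω n < 1 := by
    intro n hn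
    rcases Nat.lt_or_ge n 2 with h2 | h2
    · obtain rfl : n = 1 := by omega
      rw [hω1]
      apply inv_lt_one_of_one_lt₀
      have := hmp 1 le_rfl
      linarith
    · obtain ⟨m, rfl⟩ : ∃ m, n = m + 1 := ⟨n - 1, by omega⟩
      have e := hωstep m (by omega)
      have p := hωpos m (by omega)
      have q : (1 : ℝ) ≤ I m := by exact_mod_cast hI1 m (by omega)
      rw [← inv_inv (ω (m + 1)), e]
      apply inv_lt_one_of_one_lt₀
      linarith
  have hωI : ∀ n, 1 ≤ n → ⌊(ω (n + 1))⁻¹⌋ = I n := by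
    intro n hn
    rw [hωstep n hn, Int.floor_intCast_add, Int.floor_eq_zero_iff.2 ⟨(hωpos n hn).le, hωlt n hn⟩,
      add_zero]
  have hωF : ∀ n, 1 ≤ n → Int.fract (ω (n + 1))⁻¹ = ω n := by
    intro n hn
    rw [hωstep n hn, Int.fract_intCast_add]
    exact Int.fract_eq_self.2 ⟨(hωpos n hn).le, hωlt n hn⟩
  have main : ∀ i, i + 2 ≤ k → φ (k + i) = ω (k - 1 - i) := by
    intro i
    induction i with
    | zero => intro _; simpa using h
    | succ i ih =>
      intro hi
      have e := ih (by omega)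
      rw [← add_assoc, hstep (k + i) (by omega), e,
        show k - 1 - i = (k - 1 - (i + 1)) + 1 by omega, hωF _ (by omega)]
  have sym : ∀ i, i + 3 ≤ k → I (k + i) = I (k - 2 - i) := by
    intro i hi
    rw [hIf _ (by omega), main i (by omega), show k - 1 - i = (k - 2 - i) + 1 by omega,
      hωI _ (by omega)]
  have last : (φ (2 * k - 2))⁻¹ = s + mu 1 := by
    have e := main (k - 2) (by omega)
    rw [show k + (k - 2) = 2 * k - 2 by omega, show k - 1 - (k - 2) = 1 by omega] at e
    rw [e, hω1, inv_inv]
  have per0 : φ (2 * k - 1) = φ 1 := by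
    rw [show 2 * k - 1 = (2 * k - 2) + 1 by omega, hstep _ (by omega), last, hφ1,
      Int.fract_add_intCast]
  have per : ∀ n, φ (n + 1 + (2 * k - 2)) = φ (n + 1) := by
    intro n
    induction n with
    | zero => rw [show 0 + 1 + (2 * k - 2) = 2 * k - 1 by omega, per0]
    | succ n ih =>
      rw [show n + 1 + 1 + (2 * k - 2) = (n + 1 + (2 * k - 2)) + 1 by omega,
        hstep _ (by omega), ih, ← hstep _ (by omega)]
  refine ⟨per0, ?_, ?_, ?_⟩
  · rw [hIf _ (by omega), last, Int.floor_add_intCast, ← hmu1]; ring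
  · intro j h1 h2
    rcases lt_trichotomy j (k - 1) with hj | hj | hj
    · have e := sym (k - 2 - j) (by omega)
      rw [show k + (k - 2 - j) = 2 * k - 2 - j by omega,
        show k - 2 - (k - 2 - j) = j by omega] at e
      exact e.symm
    · rw [show 2 * k - 2 - j = j by omega]
    · have e := sym (j - k) (by omega)
      rw [show k + (j - k) = j by omega,
        show k - 2 - (j - k) = 2 * k - 2 - j by omega] at e
      exact e
  · intro n hn
    obtain ⟨m, rfl⟩ : ∃ m, n = m + 1 := ⟨n - 1, by omega⟩
    rw [hIf _ (by omega), per, ← hIf _ (by omega)]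
end

section
/- (Case II of the palindromicity proof.) Let N ≥ 2 be a non-square positive integer, with anthyphairesis quotients (I_n), increment factors (φ_n) of (√N, 1), and sequences (λ_k), (μ_k), (ω_n) as in the context. If k ≥ 1 is an index with φ_k = ω_k, then φ_{2k} = φ_1, I_{2k−1} = 2·μ_1, and I_j = I_{2k−1−j} for all j with 1 ≤ j ≤ 2k−2; consequently the anthyphairesis of (√N, 1) is periodic with palindromic period (I_1, …, I_{2k−2}, 2μ_1) of odd length 2k−1. -/
theorem palindromicity_case_II (N : ℕ) (hN : 2 ≤ N) (hsq : ¬ IsSquare N)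
    (lam mu : ℕ → ℤ)
    (hpos : ∀ k, 1 ≤ k → 0 < lam k ∧ 0 < mu k)
    (hlam1 : lam 1 = 1) (hmu1 : mu 1 = ⌊Real.sqrt (N : ℝ)⌋)
    (hphi : ∀ k, 1 ≤ k →
      (lam k : ℝ) * anthPhi (Real.sqrt (N : ℝ)) 1 k = Real.sqrt (N : ℝ) - (mu k : ℝ))
    (hlamlam : ∀ k, 1 ≤ k → lam (k + 1) * lam k = (N : ℤ) - mu k ^ 2)
    (hmuI : ∀ k, 2 ≤ k →
      mu k + mu (k - 1) = anthI (Real.sqrt (N : ℝ)) 1 (k - 1) * lam k)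
    (k : ℕ) (hk : 1 ≤ k)
    (h : anthPhi (Real.sqrt (N : ℝ)) 1 k = omegaSeq N lam mu k) :
    anthPhi (Real.sqrt (N : ℝ)) 1 (2 * k) = anthPhi (Real.sqrt (N : ℝ)) 1 1 ∧
    anthI (Real.sqrt (N : ℝ)) 1 (2 * k - 1) = 2 * mu 1 ∧
    (∀ j, 1 ≤ j → j ≤ 2 * k - 2 →
      anthI (Real.sqrt (N : ℝ)) 1 j = anthI (Real.sqrt (N : ℝ)) 1 (2 * k - 1 - j)) ∧
    (∀ n, 1 ≤ n →
      anthI (Real.sqrt (N : ℝ)) 1 (n + (2 * k - 1)) = anthI (Real.sqrt (N : ℝ)) 1 n) := by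
  have hirr : Irrational (Real.sqrt (N : ℝ)) := irrational_sqrt_natCast_iff.mpr hsq
  set s : ℝ := Real.sqrt (N : ℝ) with hs
  have hs2 : s ^ 2 = N := Real.sq_sqrt (Nat.cast_nonneg N)
  have hs0 : 0 ≤ s := Real.sqrt_nonneg _
  have hsmu : ∀ m : ℤ, s - m ≠ 0 := fun m hm => hirr.ne_int m (by linarith)
  have hphi0 : ∀ m, 1 ≤ m → anthPhi s 1 m ≠ 0 := by
    intro m hm h0
    have := hphi m hm
    rw [h0, mul_zero] at this
    exact hsmu _ this.symm
  have hg : ∀ m, anthGamma s 1 m ≠ 0 := by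
    intro m hm
    rcases Nat.eq_zero_or_pos m with rfl | h1
    · simp [anthGamma] at hm
    · exact hphi0 m h1 (by simp [anthPhi, hm])
  have hI : ∀ m, 1 ≤ m → anthI s 1 m = ⌊1 / anthPhi s 1 m⌋ := by
    intro m hm
    obtain ⟨m, rfl⟩ := Nat.exists_eq_add_of_le' hm
    simp [anthI, anthPhi]
  have hrec : ∀ m, 1 ≤ m → anthPhi s 1 (m + 1) = Int.fract (1 / anthPhi s 1 m) := by
    intro m hm
    obtain ⟨m, rfl⟩ := Nat.exists_eq_add_of_le' hm
    have h1 := hg (m + 1)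
    simp only [anthPhi, Int.fract, Nat.add_sub_cancel, one_mul, one_div_div]
    rw [anthGamma]
    field_simp
  have hp1 : anthPhi s 1 1 = Int.fract s := by
    simp [anthPhi, anthGamma]
  have hrange : ∀ m, 1 ≤ m → 0 < anthPhi s 1 m ∧ anthPhi s 1 m < 1 := by
    intro m hm
    have : ∃ x : ℝ, anthPhi s 1 m = Int.fract x := by
      rcases Nat.lt_or_ge 1 m with h2 | h2
      · obtain ⟨p, rfl⟩ := Nat.exists_eq_add_of_le' hm
        exact ⟨_, hrec p (by omega)⟩
      · obtain rfl : m = 1 := by omega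
        exact ⟨_, hp1⟩
    obtain ⟨x, hx⟩ := this
    refine ⟨lt_of_le_of_ne ?_ (hphi0 m hm).symm, ?_⟩
    · rw [hx]; exact Int.fract_nonneg x
    · rw [hx]; exact Int.fract_lt_one x
  have hlp : ∀ m, 1 ≤ m → (0 : ℝ) < lam m := fun m hm => by exact_mod_cast (hpos m hm).1
  have hmp : ∀ m, 1 ≤ m → (0 : ℝ) < mu m := fun m hm => by exact_mod_cast (hpos m hm).2
  have hll : ∀ m, 1 ≤ m → (lam (m + 1) : ℝ) * lam m = (s - mu m) * (s + mu m) := by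
    intro m hm
    have : ((lam (m + 1) * lam m : ℤ) : ℝ) = (((N : ℤ) - mu m ^ 2 : ℤ) : ℝ) := by
      rw [hlamlam m hm]
    push_cast at this
    rw [this, ← hs2]; ring
  have hinv : ∀ m, 1 ≤ m → 1 / anthPhi s 1 m = (s + mu m) / lam (m + 1) := by
    intro m hm
    have h1 := hlp m hm
    have h2 := hlp (m + 1) (by omega)
    have h3 := hphi0 m hm
    have h4 := hphi m hm
    have h5 := hll m hm
    rw [div_eq_div_iff h3 h2.ne']
    have : (lam m : ℝ) * (1 * lam (m + 1)) = lam m * ((s + mu m) * anthPhi s 1 m) := by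
      linear_combination h5 - (s + mu m) * h4
    exact mul_left_cancel₀ h1.ne' this
  have hI1 : ∀ m, 1 ≤ m → 1 ≤ anthI s 1 m := by
    intro m hm
    rw [hI m hm, Int.le_floor]
    obtain ⟨h1, h2⟩ := hrange m hm
    rw [le_div_iff₀ h1]; push_cast; linarith
  have hmuI' : ∀ m, 1 ≤ m → (mu (m + 1) : ℝ) + mu m = anthI s 1 m * lam (m + 1) := by
    intro m hm
    have := hmuI (m + 1) (by omega)
    rw [Nat.add_sub_cancel] at this
    exact_mod_cast this
  have hom : ∀ m, 1 ≤ m → (s + mu (m + 1)) / lam (m + 1) = anthI s 1 m + lam m / (s + mu m) := by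
    intro m hm
    have h1 := hlp m hm
    have h2 := hlp (m + 1) (by omega)
    have h3 := hmp m hm
    have h4 : s + mu m ≠ 0 := by positivity
    have h5 := hll m hm
    have h6 := hmuI' m hm
    field_simp
    linear_combination (s + mu m) * h6 - h5
  have hom1 : ∀ m, 1 ≤ m → lam m < s + mu m := by
    intro m hm
    rcases Nat.lt_or_ge 1 m with h2 | h2
    · obtain ⟨p, rfl⟩ := Nat.exists_eq_add_of_le' hm
      have hp : 1 ≤ p := by omega
      have h1 := hom p hp
      have h3 := hlp p hp
      have h4 := hmp p hp
      have h5 : 0 < (lam p : ℝ) / (s + mu p) := by positivity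
      have h6 : (1 : ℝ) ≤ anthI s 1 p := by exact_mod_cast hI1 p hp
      have h7 : 1 < (s + mu (p + 1)) / lam (p + 1) := by rw [h1]; linarith
      rwa [one_lt_div (hlp _ hm)] at h7
    · obtain rfl : m = 1 := by omega
      have h1 : (1 : ℝ) ≤ mu 1 := by exact_mod_cast (hpos 1 le_rfl).2
      have h3 : (2 : ℝ) ≤ N := by exact_mod_cast hN
      rw [hlam1]; push_cast
      nlinarith
  have hIA : ∀ m, 1 ≤ m → anthI s 1 m = ⌊(s + mu m) / lam (m + 1)⌋ := by
    intro m hm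
    rw [hI m hm, hinv m hm]
  have hIB : ∀ m, 1 ≤ m → anthI s 1 m = ⌊(s + mu (m + 1)) / lam (m + 1)⌋ := by
    intro m hm
    have h1 := hlp m hm
    have h3 := hmp m hm
    rw [hom m hm, Int.floor_intCast_add]
    have : ⌊(lam m : ℝ) / (s + mu m)⌋ = 0 := by
      rw [Int.floor_eq_zero_iff]
      refine ⟨by positivity, ?_⟩
      rw [div_lt_one (by positivity)]
      exact hom1 m hm
    omega
  have hk1 : lam (k + 1) = lam k := by
    have h1 := hlp k hk
    have h3 := hmp k hk
    have h4 := hphi k hk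
    have h5 := hll k hk
    have h6 : s + mu k ≠ 0 := by positivity
    rw [h, omegaSeq, ← hs] at h4
    field_simp at h4
    have : (lam (k + 1) : ℝ) * lam k = lam k * lam k := by rw [h5]; linarith
    exact_mod_cast mul_right_cancel₀ h1.ne' this
  have hstep : ∀ a b, 1 ≤ a → 1 ≤ b → lam (a + 1) = lam (b + 1) → mu a = mu (b + 1) →
      anthI s 1 a = anthI s 1 b := by
    intro a b ha hb h1 h2
    rw [hIA a ha, hIB b hb, h1, h2]
  have key : ∀ i j, j + 1 + i = k → lam (k + 1 + i) = lam (j + 1) ∧ mu (k + i) = mu (j + 1) := by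
    intro i
    induction i with
    | zero => intro j hj; obtain rfl : k = j + 1 := by omega
              exact ⟨hk1, rfl⟩
    | succ i ih =>
      intro j hj
      obtain ⟨h1, h2⟩ := ih (j + 1) (by omega)
      have e1 : k + 1 + i = k + i + 1 := by ring
      rw [e1] at h1
      have h3 := hstep (k + i) (j + 1) (by omega) (by omega) h1 h2
      have h4 := hmuI (k + i + 1) (by omega)
      have h5 := hmuI (j + 1 + 1) (by omega)
      simp only [Nat.add_sub_cancel] at h4 h5
      have h6 : mu (k + (i + 1)) = mu (j + 1) := by
        rw [h3, h1, ← h5, h2] at h4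
        rw [← add_assoc]; linarith
      refine ⟨?_, h6⟩
      have h7 := hlamlam (k + (i + 1)) (by omega)
      have h8 := hlamlam (j + 1) (by omega)
      rw [h6, ← h8, ← add_assoc k i 1, h1, mul_comm] at h7
      have h9 := (hpos (j + 1 + 1) (by omega)).1
      have e2 : k + 1 + (i + 1) = k + i + 1 + 1 := by ring
      rw [e2]
      exact mul_left_cancel₀ h9.ne' h7
  have pal : ∀ j, 1 ≤ j → j < k → anthI s 1 (2 * k - 1 - j) = anthI s 1 j := by
    intro j hj hjk
    obtain ⟨i, hi⟩ : ∃ i, k = j + 1 + i := ⟨k - j - 1, by omega⟩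
    obtain ⟨h1, h2⟩ := key i j hi.symm
    have e : 2 * k - 1 - j = k + i := by omega
    rw [e]
    exact hstep _ _ (by omega) hj (by rw [← h1]; congr 1; ring) h2
  obtain ⟨hl, hm⟩ := key (k - 1) 0 (by omega)
  have e1 : k + 1 + (k - 1) = 2 * k := by omega
  have e2 : k + (k - 1) = 2 * k - 1 := by omega
  rw [e1, zero_add, hlam1] at hl
  rw [e2, zero_add] at hm
  have hmu2k : mu (2 * k) = mu 1 := by
    obtain ⟨h1, h2⟩ := hrange (2 * k) (by omega)
    have h3 := hphi (2 * k) (by omega)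
    rw [hl] at h3
    push_cast at h3
    rw [hmu1, eq_comm, Int.floor_eq_iff]
    constructor <;> linarith
  have hper : anthPhi s 1 (2 * k) = anthPhi s 1 1 := by
    have h3 := hphi (2 * k) (by omega)
    have h4 := hphi 1 le_rfl
    rw [hl, hmu2k] at h3
    rw [hlam1] at h4
    push_cast at h3 h4
    linarith
  have hperiod : ∀ n, 1 ≤ n → anthPhi s 1 (n + (2 * k - 1)) = anthPhi s 1 n := by
    intro n hn
    induction n, hn using Nat.le_induction with
    | base => rw [← hper]; congr 1; omega
    | succ n hn ih =>
      rw [hrec n hn, ← ih, ← hrec _ (by omega)]; congr 1; omega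
  refine ⟨hper, ?_, ?_, ?_⟩
  · have h1 := hmuI (2 * k) (by omega)
    rw [hl, hm, hmu2k] at h1
    linarith
  · intro j h1 h2
    rcases Nat.lt_or_ge j k with h3 | h3
    · exact (pal j h1 h3).symm
    · have := pal (2 * k - 1 - j) (by omega) (by omega)
      rw [← this]; congr 1; omega
  · intro n hn
    rw [hI _ (by omega), hI n hn, hperiod n hn]
end
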